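/- arXiv:1601.07821 — 13 statements merged into one kernel-verified Lean document; each statement's English description precedes it below -/
import Mathlib

section
/- Let E be a metric space with distance ρ, let f : E → ℝ be Lipschitz with smallest Lipschitz constant ‖f‖, and suppose f attains its norm on a pair (x,y) ∈ E×E with x ≠ y, i.e. |f(x)-f(y)| = ‖f‖·ρ(x,y). If z ∈ E \ {x,y} is such that ρ(x,y) = ρ(x,z) + ρ(z,y), then f strongly attains its norm on the pairs (x,z) and (z,y), i.e. |f(x)-f(z)| = ‖f‖·ρ(x,z) and |f(z)-f(y)| = ‖f‖·ρ(z,y), and moreover f(z) = (ρ(z,y)·f(x) + ρ(x,z)·f(y))/ρ(x,y). -/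
open Filter Topology

/-- `L` is the smallest Lipschitz constant of `f` (the Lipschitz norm of `f`). -/
def IsLipNorm {E : Type*} [PseudoMetricSpace E] (f : E → ℝ) (L : ℝ) : Prop :=
  IsLeast {K : ℝ | 0 ≤ K ∧ ∀ x y : E, |f x - f y| ≤ K * dist x y} L

theorem stmt0 {E : Type*} [MetricSpace E] (f : E → ℝ) (L : ℝ)
    (hL : IsLipNorm f L) (x y z : E) (hxy : x ≠ y) (hzx : z ≠ x) (hzy : z ≠ y)
    (hatt : |f x - f y| = L * dist x y)
    (hmid : dist x y = dist x z + dist z y) :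
    |f x - f z| = L * dist x z ∧ |f z - f y| = L * dist z y ∧
      f z = (dist z y * f x + dist x z * f y) / dist x y := by
  have hxz := hL.1.2 x z
  have hzy' := hL.1.2 z y
  have htri : |f x - f y| ≤ |f x - f z| + |f z - f y| := abs_sub_le _ _ _
  have hsum : L * dist x y = L * dist x z + L * dist z y := by rw [hmid, mul_add]
  have h₁ : |f x - f z| = L * dist x z := by linarith
  have h₂ : |f z - f y| = L * dist z y := by linarith
  refine ⟨h₁, h₂, ?_⟩
  rw [eq_div_iff (dist_pos.2 hxy).ne', hmid]
  have hle₁ := abs_le.1 hxz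
  have hle₂ := abs_le.1 hzy'
  rcases abs_choice (f x - f y) with h | h
  · have hu : f x - f z = L * dist x z := by linarith
    have hv : f z - f y = L * dist z y := by linarith
    linear_combination dist x z * hv - dist z y * hu
  · have hu : f x - f z = -(L * dist x z) := by linarith
    have hv : f z - f y = -(L * dist z y) := by linarith
    linear_combination dist x z * hv - dist z y * hu
end

section
/- Let X be a real normed space and let f : X → ℝ be Lipschitz with smallest Lipschitz constant ‖f‖. If f attains its norm on a pair (x,y) ∈ X×X with x ≠ y, i.e. |f(x)-f(y)| = ‖f‖·‖x-y‖, then f is affine on the closed segment conv{x,y}: for every θ ∈ [0,1], f(θx + (1-θ)y) = θ·f(x) + (1-θ)·f(y). -/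
open Filter Topology

theorem stmt1 {X : Type*} [NormedAddCommGroup X] [NormedSpace ℝ X]
    (f : X → ℝ) (L : ℝ) (hL : IsLipNorm f L) (x y : X) (hxy : x ≠ y)
    (hatt : |f x - f y| = L * ‖x - y‖) :
    ∀ θ : ℝ, θ ∈ Set.Icc (0:ℝ) 1 →
      f (θ • x + (1 - θ) • y) = θ * f x + (1 - θ) * f y := by
  rintro θ ⟨h0, h1⟩
  set z := θ • x + (1 - θ) • y with hz
  have hxz : |f x - f z| ≤ (1 - θ) * |f x - f y| := by
    have hd : dist x z = (1 - θ) * ‖x - y‖ := by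
      have : x - z = (1 - θ) • (x - y) := by rw [hz]; module
      rw [dist_eq_norm, this, norm_smul, Real.norm_of_nonneg (sub_nonneg.2 h1)]
    calc |f x - f z| ≤ L * dist x z := hL.1.2 x z
      _ = (1 - θ) * |f x - f y| := by rw [hd, hatt]; ring
  have hzy : |f z - f y| ≤ θ * |f x - f y| := by
    have hd : dist z y = θ * ‖x - y‖ := by
      have : z - y = θ • (x - y) := by rw [hz]; module
      rw [dist_eq_norm, this, norm_smul, Real.norm_of_nonneg h0]
    calc |f z - f y| ≤ L * dist z y := hL.1.2 z y
      _ = θ * |f x - f y| := by rw [hd, hatt]; ring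
  rw [abs_le] at hxz hzy
  rcases abs_cases (f x - f y) with ⟨h, -⟩ | ⟨h, -⟩ <;> rw [h] at hxz hzy <;> linarith
end

section
/- There exists a function g : [0,1] → ℝ with g(0) = 0 and Lipschitz norm ‖g‖ = 1 such that for every f : [0,1] → ℝ with f(0) = 0 that attains its norm in the strong sense, the Lipschitz norm of g - f is at least 1/2. Consequently, SA([0,1]) is not dense in Lip_0([0,1]). -/
open Filter Topology

/-- `f` attains its (Lipschitz) norm in the strong sense: there are `x ≠ y` with
`|f x - f y| = ‖f‖ · ρ(x,y)` where `‖f‖` is the smallest Lipschitz constant of `f`. -/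
def StronglyAttains {E : Type*} [PseudoMetricSpace E] (f : E → ℝ) : Prop :=
  ∃ L : ℝ, IsLipNorm f L ∧ ∃ x y : E, x ≠ y ∧ |f x - f y| = L * dist x y

open MeasureTheory in
/-- A nonconstant `1`-Lipschitz function on the line which is constant on some nontrivial
subinterval of every nontrivial interval. -/
theorem exists_nonconstant_lipschitz_dense_constancy :
    ∃ h : ℝ → ℝ, h 0 = 0 ∧ 0 < h 1 ∧ (∀ x y, |h x - h y| ≤ |x - y|) ∧
      ∀ a b, a < b → ∃ u v, a < u ∧ u < v ∧ v < b ∧ h u = h v := by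
  have hQ : volume (Set.range ((↑) : ℚ → ℝ)) < 1 := by
    rw [(Set.countable_range _).measure_zero]
    exact one_pos
  obtain ⟨U, hQU, hU, hU1⟩ := Set.exists_isOpen_lt_of_lt _ _ hQ
  have hfin (a b : ℝ) : volume (Set.Ioc a b \ U) ≠ ⊤ :=
    ((measure_mono Set.sdiff_subset).trans_lt measure_Ioc_lt_top).ne
  have hdiff (x y : ℝ) :
      (∫ t in (0 : ℝ)..y, Uᶜ.indicator 1 t) - ∫ t in (0 : ℝ)..x, Uᶜ.indicator 1 t =
      ∫ t in x..y, Uᶜ.indicator (1 : ℝ → ℝ) t := by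
    have hint (a b : ℝ) : IntervalIntegrable (Uᶜ.indicator (1 : ℝ → ℝ)) volume a b := by
      rw [intervalIntegrable_iff]
      exact (integrableOn_const (C := (1 : ℝ)) (by simp)).indicator hU.measurableSet.compl
    exact intervalIntegral.integral_interval_sub_left (hint _ _) (hint _ _)
  refine ⟨fun x => ∫ t in (0 : ℝ)..x, Uᶜ.indicator 1 t, by simp, ?_, fun x y => ?_,
    fun a b hab => ?_⟩
  · simp only
    rw [intervalIntegral.integral_of_le zero_le_one,
      integral_indicator_one hU.measurableSet.compl,
      measureReal_restrict_apply hU.measurableSet.compl,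
      Set.inter_comm, ← Set.sdiff_eq]
    refine ENNReal.toReal_pos (fun h0 => ?_) (hfin 0 1)
    have h1 : volume (Set.Ioc (0 : ℝ) 1) ≤ volume (Set.Ioc (0 : ℝ) 1 \ U) + volume U :=
      (measure_mono (by rw [Set.sdiff_union_self]; exact Set.subset_union_left)).trans
        (measure_union_le _ _)
    rw [h0, zero_add, Real.volume_Ioc] at h1
    norm_num at h1
    exact absurd hU1 h1.not_gt
  · rw [hdiff y x, ← Real.norm_eq_abs]
    refine (intervalIntegral.norm_integral_le_of_norm_le_const (C := 1) fun t _ => ?_).trans_eq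
      (one_mul _)
    exact (norm_indicator_le_norm_self _ _).trans (by simp)
  · obtain ⟨q, haq, hqb⟩ := exists_rat_btwn hab
    obtain ⟨ε, hε, hball⟩ := Metric.isOpen_iff.1 hU q (hQU ⟨q, rfl⟩)
    obtain ⟨v, hqv, hv⟩ := exists_between (lt_min hqb (lt_add_of_pos_right (q : ℝ) hε))
    rw [lt_min_iff] at hv
    refine ⟨q, v, haq, hqv, hv.1, (sub_eq_zero.1 ?_).symm⟩
    rw [hdiff]
    refine (intervalIntegral.integral_congr (g := fun _ => (0 : ℝ)) fun t ht => ?_).trans (by simp)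
    rw [Set.uIcc_of_le hqv.le] at ht
    refine Set.indicator_of_notMem (Set.notMem_compl_iff.2 (hball ?_)) _
    rw [Metric.mem_ball, Real.dist_eq, abs_lt]
    constructor <;> linarith [ht.1, ht.2]

theorem exists_isLipNorm {E : Type*} [PseudoMetricSpace E] {f : E → ℝ} {K : ℝ} (hK : 0 ≤ K)
    (hf : ∀ x y, |f x - f y| ≤ K * dist x y) : ∃ L, IsLipNorm f L := by
  refine ⟨_, IsClosed.isLeast_csInf ?_ ⟨K, hK, hf⟩ ⟨0, fun _ h => h.1⟩⟩
  simp only [Set.ofPred_and, Set.ofPred_forall]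
  exact isClosed_Ici.inter (isClosed_iInter fun x => isClosed_iInter fun y =>
    isClosed_le continuous_const (by fun_prop))

theorem IsLipNorm.div_self {E : Type*} [PseudoMetricSpace E] {f : E → ℝ} {L : ℝ}
    (hf : IsLipNorm f L) (hL : 0 < L) : IsLipNorm (fun x => f x / L) 1 := by
  refine ⟨⟨zero_le_one, fun x y => ?_⟩, fun K hK => ?_⟩
  · rw [← sub_div, abs_div, abs_of_pos hL, div_le_iff₀ hL]
    linarith [hf.1.2 x y]
  · refine le_of_mul_le_mul_right ?_ hL
    rw [one_mul]
    refine hf.2 ⟨mul_nonneg hK.1 hL.le, fun x y => ?_⟩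
    have := hK.2 x y
    rw [← sub_div, abs_div, abs_of_pos hL, div_le_iff₀ hL] at this
    linarith

/-- A strongly attaining function on the unit interval has maximal slope between any two points
of some nontrivial subinterval. -/
theorem StronglyAttains.exists_lt_forall {f : unitInterval → ℝ} (hf : StronglyAttains f) :
    ∃ L, IsLipNorm f L ∧ ∃ x y : unitInterval, x < y ∧
      ∀ u v : unitInterval, x ≤ u → u ≤ v → v ≤ y → L * dist u v ≤ |f u - f v| := by
  obtain ⟨L, hL, x, y, hxy, h⟩ := hf
  wlog hlt : x < y generalizing x y
  · exact this y x hxy.symm (by rw [abs_sub_comm, h, dist_comm])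
      (lt_of_le_of_ne (not_lt.1 hlt) hxy.symm)
  refine ⟨L, hL, x, y, hlt, fun u v hxu huv hvy => ?_⟩
  have hd : dist x y = dist x u + dist u v + dist v y := by
    have dist_of_le {a b : unitInterval} (hab : a ≤ b) : dist a b = (b : ℝ) - a := by
      rw [dist_comm, Subtype.dist_eq, Real.dist_eq, abs_of_nonneg (sub_nonneg.2 (Subtype.coe_le_coe.2 hab))]
    rw [dist_of_le hlt.le, dist_of_le hxu, dist_of_le huv, dist_of_le hvy]
    ring
  have h1 : |f x - f y| ≤ |f x - f u| + |f u - f v| + |f v - f y| :=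
    (abs_sub_le _ (f v) _).trans (add_le_add_left (abs_sub_le _ _ _) _)
  rw [h, hd] at h1
  linarith [hL.1.2 x u, hL.1.2 v y]

theorem stmt2 :
    ∃ g : unitInterval → ℝ, g 0 = 0 ∧ IsLipNorm g 1 ∧
      ∀ f : unitInterval → ℝ, f 0 = 0 → StronglyAttains f →
        ∀ M : ℝ, IsLipNorm (fun t => g t - f t) M → (1:ℝ)/2 ≤ M := by
  obtain ⟨h, h0, h1, hlip, hconst⟩ := exists_nonconstant_lipschitz_dense_constancy
  obtain ⟨N, hN⟩ := exists_isLipNorm (f := fun t : unitInterval => h t) zero_le_one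
    fun x y => by rw [one_mul]; exact hlip x y
  have hN0 : 0 < N := by
    have := hN.1.2 1 0
    simp only [Set.Icc.coe_one, Set.Icc.coe_zero, h0, sub_zero, abs_of_pos h1, Subtype.dist_eq,
      Real.dist_eq, abs_one, mul_one] at this
    exact h1.trans_le this
  have hg := hN.div_self hN0
  refine ⟨_, by simp [h0], hg, fun f _ hf M hM => ?_⟩
  obtain ⟨L, hL, x, y, hxy, hslope⟩ := hf.exists_lt_forall
  have hLM : 1 ≤ L + M := hg.2 ⟨add_nonneg hL.1.1 hM.1.1, fun a b => by
    have h2 := abs_add_le (f a - f b) ((h a / N - f a) - (h b / N - f b))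
    rw [show f a - f b + ((h a / N - f a) - (h b / N - f b)) = h a / N - h b / N by ring] at h2
    linarith [hL.1.2 a b, hM.1.2 a b]⟩
  obtain ⟨u, v, hxu, huv, hvy, he⟩ := hconst x y hxy
  lift u to unitInterval using ⟨x.2.1.trans hxu.le, (huv.trans hvy).le.trans y.2.2⟩
  lift v to unitInterval using ⟨u.2.1.trans huv.le, hvy.le.trans y.2.2⟩
  have hML : L ≤ M := by
    refine le_of_mul_le_mul_right ((hslope u v hxu.le huv.le hvy.le).trans ?_)
      (dist_pos.2 (ne_of_lt huv))
    have := hM.1.2 u v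
    beta_reduce at this
    rwa [he, sub_sub_sub_cancel_left, abs_sub_comm] at this
  linarith
end

section
/- Let E be a local pointed metric space. Then for every g ∈ Lip_0(E) there is a sequence {g_n} in SA(E) such that ‖g_n‖ → ‖g‖ and g_n → g uniformly on E. -/
open Filter Topology

/-- A pointed metric space `(E, e₀)` is local. -/
def IsLocal {E : Type*} [MetricSpace E] (e₀ : E) : Prop :=
  ∀ ε > (0:ℝ), ∀ f : E → ℝ, f e₀ = 0 → ∀ L : ℝ, IsLipNorm f L →
    ∃ t₁ t₂ : E, t₁ ≠ t₂ ∧ dist t₁ t₂ < ε ∧ (f t₂ - f t₁) / dist t₁ t₂ > L - ε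

/-- If `g` is `L`-Lipschitz with slope `> L - ε` between two points at distance `< ε ≤ 1`, then `g`
is `ε`-close to a function of Lipschitz norm `L` attaining its norm at these points. -/
theorem exists_isLipNorm_attaining_near {E : Type*} [MetricSpace E] (e₀ : E)
    {g : E → ℝ} (hg0 : g e₀ = 0) {L : ℝ} (hL : 0 ≤ L)
    (hg : ∀ x y : E, |g x - g y| ≤ L * dist x y) {ε : ℝ} (hε1 : ε ≤ 1) {t₁ t₂ : E}
    (hne : t₁ ≠ t₂) (hd : dist t₁ t₂ < ε) (hs : (g t₂ - g t₁) / dist t₁ t₂ > L - ε) :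
    ∃ h : E → ℝ, h e₀ = 0 ∧ IsLipNorm h L ∧
      (∃ x y : E, x ≠ y ∧ |h x - h y| = L * dist x y) ∧ ∀ x, |g x - h x| < ε := by
  have hpos : 0 < dist t₁ t₂ := dist_pos.2 hne
  have hs' : (L - ε) * dist t₁ t₂ < g t₂ - g t₁ := (lt_div_iff₀ hpos).1 hs
  have hle : ∀ x y, g x - g y ≤ L * dist x y := fun x y => (le_abs_self _).trans (hg x y)
  let m : E → ℝ := fun x => max (g x) (g t₁ + L * dist t₁ t₂ - L * dist x t₂)
  have hm1 : m t₁ = g t₁ := by simp [m]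
  have hm2 : m t₂ = g t₁ + L * dist t₁ t₂ := by
    have := hle t₂ t₁
    rw [dist_comm] at this
    simp only [m, dist_self, mul_zero, sub_zero]
    exact max_eq_right (by linarith)
  have hmle : ∀ x y, m x - m y ≤ L * dist x y := by
    intro x y
    have h1 := hle x y
    have h2 := mul_le_mul_of_nonneg_left (dist_triangle_left y t₂ x) hL
    have h3 : g y ≤ m y := le_max_left _ _
    have h4 : g t₁ + L * dist t₁ t₂ - L * dist y t₂ ≤ m y := le_max_right _ _
    have : m x ≤ m y + L * dist x y := max_le (by linarith) (by linarith)
    linarith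
  have hmlip : ∀ x y, |m x - m y| ≤ L * dist x y := fun x y =>
    abs_sub_le_iff.2 ⟨hmle x y, dist_comm x y ▸ hmle y x⟩
  have hlow : ∀ x, g x ≤ m x := fun x => le_max_left _ _
  have hup : ∀ x, m x < g x + ε := by
    intro x
    have h1 := hle t₂ x
    rw [dist_comm] at h1
    have h2 : 0 < ε := hpos.trans hd
    exact max_lt (by linarith) (by nlinarith)
  have hatt : |m t₁ - m t₂| = L * dist t₁ t₂ := by
    rw [hm1, hm2, sub_add_cancel_left, abs_neg, abs_of_nonneg (by positivity)]
  refine ⟨fun x => m x - m e₀, sub_self _, ⟨⟨hL, ?_⟩, ?_⟩, ⟨t₁, t₂, hne, ?_⟩, ?_⟩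
  · simpa using hmlip
  · rintro K ⟨-, hK⟩
    have := hK t₁ t₂
    rw [sub_sub_sub_cancel_right, hatt] at this
    exact le_of_mul_le_mul_right this hpos
  · simpa using hatt
  · intro x
    have h1 := hlow x
    have h2 := hup x
    have h3 := hlow e₀
    have h4 := hup e₀
    exact abs_lt.2 ⟨by linarith, by linarith⟩

theorem stmt5 {E : Type*} [MetricSpace E] (e₀ : E) (hloc : IsLocal e₀)
    (g : E → ℝ) (hg0 : g e₀ = 0) (L : ℝ) (hgL : IsLipNorm g L) :
    ∃ (gs : ℕ → E → ℝ) (Ls : ℕ → ℝ),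
      (∀ n, gs n e₀ = 0) ∧ (∀ n, IsLipNorm (gs n) (Ls n)) ∧
      (∀ n, ∃ x y : E, x ≠ y ∧ |gs n x - gs n y| = Ls n * dist x y) ∧
      Tendsto Ls atTop (𝓝 L) ∧
      TendstoUniformly gs g atTop := by
  have key : ∀ n : ℕ, ∃ h : E → ℝ, h e₀ = 0 ∧ IsLipNorm h L ∧
      (∃ x y : E, x ≠ y ∧ |h x - h y| = L * dist x y) ∧
      ∀ x, |g x - h x| < 1 / ((n : ℝ) + 1) := by
    intro n
    obtain ⟨t₁, t₂, hne, hd, hs⟩ := hloc (1 / ((n : ℝ) + 1)) (by positivity) g hg0 L hgL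
    exact exists_isLipNorm_attaining_near e₀ hg0 hgL.1.1 hgL.1.2
      (div_le_one_of_le₀ (by simp) (by positivity)) hne hd hs
  choose gs h0 hlip hatt hclose using key
  refine ⟨gs, fun _ => L, h0, hlip, hatt, tendsto_const_nhds, ?_⟩
  rw [Metric.tendstoUniformly_iff]
  intro ε hε
  filter_upwards [(tendsto_one_div_add_atTop_nhds_zero_nat (𝕜 := ℝ)).eventually_lt_const hε]
    with n hn x
  exact (hclose n x).trans hn
end

section
/- Let X be a real Banach space with X ≠ {0}. Then for every g ∈ Lip_0(X) there is a sequence {g_n} in SA(X) such that ‖g_n‖ → ‖g‖ and g_n → g uniformly on the whole of X. -/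
open Filter Topology

/-- A Lipschitz bound that is an equality at some pair of distinct points is the Lipschitz norm. -/
lemma isLipNorm_of_attained {X : Type*} [NormedAddCommGroup X] {f : X → ℝ} {L : ℝ} (hL : 0 ≤ L)
    (hf : ∀ x y : X, |f x - f y| ≤ L * dist x y)
    (hatt : ∃ x y : X, x ≠ y ∧ |f x - f y| = L * ‖x - y‖) : IsLipNorm f L := by
  refine ⟨⟨hL, hf⟩, fun K hK => ?_⟩
  obtain ⟨x, y, hxy, h⟩ := hatt
  have hle := hK.2 x y
  rw [h, dist_eq_norm] at hle
  exact le_of_mul_le_mul_right hle (norm_pos_iff.2 (sub_ne_zero.2 hxy))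

/-- The maximum of `g - ε` with the downward cone of slope `L` at the origin is a perturbation
of `g` by at most `ε`, and near the origin it coincides with the cone. -/
lemma coneMax_spec {X : Type*} [NormedAddCommGroup X] [NormedSpace ℝ X] [Nontrivial X]
    {g : X → ℝ} (hg0 : g 0 = 0) {L : ℝ} (hL : 0 ≤ L)
    (hg : ∀ x y : X, |g x - g y| ≤ L * dist x y) {ε : ℝ} (hε : 0 < ε) :
    max (g 0 - ε) (-(L * ‖(0 : X)‖)) = 0 ∧
    (∀ x y : X, |max (g x - ε) (-(L * ‖x‖)) - max (g y - ε) (-(L * ‖y‖))| ≤ L * dist x y) ∧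
    (∃ x y : X, x ≠ y ∧
      |max (g x - ε) (-(L * ‖x‖)) - max (g y - ε) (-(L * ‖y‖))| = L * ‖x - y‖) ∧
    ∀ x : X, |g x - max (g x - ε) (-(L * ‖x‖))| ≤ ε := by
  have hbd : ∀ x, |g x| ≤ L * ‖x‖ := fun x => by simpa [hg0] using hg x 0
  have hzero : max (g 0 - ε) (-(L * ‖(0 : X)‖)) = 0 := by simp [hg0, hε.le]
  refine ⟨hzero, fun x y => ?_, ?_, fun x => ?_⟩
  · refine (abs_max_sub_max_le_max _ _ _ _).trans (max_le ?_ ?_)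
    · simpa using hg x y
    · rw [neg_sub_neg, ← mul_sub, abs_mul, abs_of_nonneg hL, dist_comm, dist_eq_norm]
      exact mul_le_mul_of_nonneg_left (abs_norm_sub_norm_le y x) hL
  · obtain ⟨z, hz⟩ := exists_norm_eq X (c := ε / (2 * (L + 1))) (by positivity)
    have hzpos : 0 < ‖z‖ := by rw [hz]; positivity
    have hsmall : 2 * (L * ‖z‖) ≤ ε := by
      have : 2 * (L + 1) * ‖z‖ = ε := by rw [hz]; field_simp
      linarith
    refine ⟨z, 0, norm_pos_iff.1 hzpos, ?_⟩
    rw [hzero, max_eq_right (by linarith [(abs_le.1 (hbd z)).2]), sub_zero, sub_zero, abs_neg,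
      abs_of_nonneg (by positivity)]
  · have hle : max (g x - ε) (-(L * ‖x‖)) ≤ g x :=
      max_le (by linarith) (abs_le.1 (hbd x)).1
    rw [abs_of_nonneg (by linarith)]
    linarith [le_max_left (g x - ε) (-(L * ‖x‖))]

theorem stmt6 {X : Type*} [NormedAddCommGroup X] [NormedSpace ℝ X]
    [CompleteSpace X] [Nontrivial X]
    (g : X → ℝ) (hg0 : g 0 = 0) (L : ℝ) (hgL : IsLipNorm g L) :
    ∃ (gs : ℕ → X → ℝ) (Ls : ℕ → ℝ),
      (∀ n, gs n 0 = 0) ∧ (∀ n, IsLipNorm (gs n) (Ls n)) ∧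
      (∀ n, ∃ x y : X, x ≠ y ∧ |gs n x - gs n y| = Ls n * ‖x - y‖) ∧
      Tendsto Ls atTop (𝓝 L) ∧
      TendstoUniformly gs g atTop := by
  obtain ⟨⟨hL, hg⟩, -⟩ := hgL
  have key := fun n : ℕ => coneMax_spec hg0 hL hg (ε := 1 / ((n : ℝ) + 1)) (by positivity)
  refine ⟨fun n x => max (g x - 1 / ((n : ℝ) + 1)) (-(L * ‖x‖)), fun _ => L,
    fun n => (key n).1, fun n => isLipNorm_of_attained hL (key n).2.1 (key n).2.2.1,
    fun n => (key n).2.2.1, tendsto_const_nhds, ?_⟩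
  rw [Metric.tendstoUniformly_iff]
  intro δ hδ
  filter_upwards [tendsto_one_div_add_atTop_nhds_zero_nat.eventually_lt_const hδ] with n hn x
  exact ((key n).2.2.2 x).trans_lt hn
end

section
/- Let X be a real Banach space with X ≠ {0}, let p be a continuous seminorm on X, and write ‖p‖_∞ = sup{p(x) : ‖x‖ = 1}. Then the following conditions are equivalent: (i) there exists z ∈ X with ‖z‖ = 1 and p(z) = ‖p‖_∞; (ii) there exist x,y ∈ X with x ≠ y such that |p(x)-p(y)|/‖x-y‖ = ‖p‖_∞; (iii) there exists a sequence of pairs (x_n,y_n) in X×X with x_n ≠ y_n for all n such that the sequence (x_n-y_n)/‖x_n-y_n‖ converges in X and (p(x_n)-p(y_n))/‖x_n-y_n‖ → ‖p‖_∞. -/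
open Filter Topology

/-- An absolutely homogeneous function that is continuous is bounded on the unit sphere. -/
theorem bddAbove_image_unit_sphere {X : Type*} [NormedAddCommGroup X] [NormedSpace ℝ X]
    (p : X → ℝ) (hhom : ∀ (l : ℝ) (x : X), p (l • x) = |l| * p x) (hcont : Continuous p) :
    BddAbove (p '' {x : X | ‖x‖ = 1}) := by
  have h0 : p 0 = 0 := by simpa using hhom 0 0
  obtain ⟨δ, hδ, h⟩ := Metric.continuousAt_iff.1 (hcont.continuousAt (x := 0)) 1 one_pos
  refine ⟨(δ / 2)⁻¹, ?_⟩
  rintro _ ⟨x, hx, rfl⟩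
  have hx1 : ‖x‖ = 1 := hx
  have hδ2 : 0 < δ / 2 := half_pos hδ
  have hlt := h (x := (δ / 2) • x) (by
    rw [dist_zero_right, norm_smul, hx1, Real.norm_of_nonneg hδ2.le]
    linarith)
  rw [h0, dist_zero_right, hhom, abs_of_pos hδ2] at hlt
  have hle : δ / 2 * p x ≤ 1 := (le_abs_self _).trans hlt.le
  rw [← one_div, le_div_iff₀ hδ2]
  linarith

/-- The difference quotient of a seminorm is at most its value in the normalized direction. -/
theorem sub_div_norm_le_apply_normalized {X : Type*} [NormedAddCommGroup X] [NormedSpace ℝ X]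
    (p : X → ℝ) (hhom : ∀ (l : ℝ) (x : X), p (l • x) = |l| * p x)
    (hsub : ∀ x y : X, p (x + y) ≤ p x + p y) (x y : X) :
    (p x - p y) / ‖x - y‖ ≤ p (‖x - y‖⁻¹ • (x - y)) := by
  have h := hsub (x - y) y
  rw [sub_add_cancel] at h
  rw [hhom, abs_of_nonneg (inv_nonneg.2 (norm_nonneg _)), div_eq_inv_mul]
  gcongr
  linarith

theorem stmt8 {X : Type*} [NormedAddCommGroup X] [NormedSpace ℝ X]
    [CompleteSpace X] [Nontrivial X]
    (p : X → ℝ) (hhom : ∀ (l : ℝ) (x : X), p (l • x) = |l| * p x)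
    (hsub : ∀ x y : X, p (x + y) ≤ p x + p y) (hcont : Continuous p)
    (M : ℝ) (hM : M = sSup (p '' {x : X | ‖x‖ = 1})) :
    ((∃ z : X, ‖z‖ = 1 ∧ p z = M) ↔
      (∃ x y : X, x ≠ y ∧ |p x - p y| / ‖x - y‖ = M)) ∧
    ((∃ x y : X, x ≠ y ∧ |p x - p y| / ‖x - y‖ = M) ↔
      (∃ xs ys : ℕ → X, (∀ n, xs n ≠ ys n) ∧
        (∃ u : X, Tendsto (fun n => ‖xs n - ys n‖⁻¹ • (xs n - ys n)) atTop (𝓝 u)) ∧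
        Tendsto (fun n => (p (xs n) - p (ys n)) / ‖xs n - ys n‖) atTop (𝓝 M))) := by
  have attained_to_pair : (∃ z : X, ‖z‖ = 1 ∧ p z = M) →
      ∃ x y : X, x ≠ y ∧ |p x - p y| / ‖x - y‖ = M := by
    rintro ⟨z, hz, hpz⟩
    have h0 : p 0 = 0 := by simpa using hhom 0 0
    have hneg : p (-z) = p z := by simpa using hhom (-1) z
    have hnonneg : 0 ≤ p z := by
      have h := hsub z (-z)
      rw [add_neg_cancel, h0, hneg] at h
      linarith
    refine ⟨z, 0, norm_ne_zero_iff.1 (by simp [hz]), ?_⟩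
    rw [h0, sub_zero, sub_zero, hz, div_one, abs_of_nonneg hnonneg, hpz]
  have pair_to_seq : (∃ x y : X, x ≠ y ∧ |p x - p y| / ‖x - y‖ = M) →
      ∃ xs ys : ℕ → X, (∀ n, xs n ≠ ys n) ∧
        (∃ u : X, Tendsto (fun n => ‖xs n - ys n‖⁻¹ • (xs n - ys n)) atTop (𝓝 u)) ∧
        Tendsto (fun n => (p (xs n) - p (ys n)) / ‖xs n - ys n‖) atTop (𝓝 M) := by
    rintro ⟨x, y, hxy, rfl⟩
    rcases le_total (p y) (p x) with h | h
    · refine ⟨fun _ => x, fun _ => y, fun _ => hxy, ⟨_, tendsto_const_nhds⟩, ?_⟩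
      rw [abs_of_nonneg (sub_nonneg.2 h)]
      exact tendsto_const_nhds
    · refine ⟨fun _ => y, fun _ => x, fun _ => hxy.symm, ⟨_, tendsto_const_nhds⟩, ?_⟩
      rw [abs_sub_comm, norm_sub_rev, abs_of_nonneg (sub_nonneg.2 h)]
      exact tendsto_const_nhds
  have seq_to_attained : (∃ xs ys : ℕ → X, (∀ n, xs n ≠ ys n) ∧
        (∃ u : X, Tendsto (fun n => ‖xs n - ys n‖⁻¹ • (xs n - ys n)) atTop (𝓝 u)) ∧
        Tendsto (fun n => (p (xs n) - p (ys n)) / ‖xs n - ys n‖) atTop (𝓝 M)) →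
      ∃ z : X, ‖z‖ = 1 ∧ p z = M := by
    rintro ⟨xs, ys, hne, ⟨u, hu⟩, hlim⟩
    have hnorm : ‖u‖ = 1 := by
      refine tendsto_nhds_unique hu.norm (tendsto_const_nhds.congr fun n => ?_)
      rw [norm_smul, norm_inv, norm_norm,
        inv_mul_cancel₀ (norm_ne_zero_iff.2 (sub_ne_zero.2 (hne n)))]
    refine ⟨u, hnorm, le_antisymm ?_ ?_⟩
    · rw [hM]
      exact le_csSup (bddAbove_image_unit_sphere p hhom hcont) ⟨u, hnorm, rfl⟩
    · exact le_of_tendsto_of_tendsto' hlim ((hcont.tendsto u).comp hu)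
        fun n => sub_div_norm_le_apply_normalized p hhom hsub (xs n) (ys n)
  exact ⟨⟨attained_to_pair, fun h => seq_to_attained (pair_to_seq h)⟩,
    ⟨pair_to_seq, fun h => attained_to_pair (seq_to_attained h)⟩⟩
end

section
/- Let X be a real Banach space with X ≠ {0}, let p be a continuous seminorm on X, let Y be a real normed space, and let T : X → Y be a bounded linear operator such that p(x) = ‖Tx‖ for all x ∈ X. If there exists a sequence of pairs (x_n,y_n) in X×X with x_n ≠ y_n for all n such that the sequence (x_n-y_n)/‖x_n-y_n‖ converges in X and (p(x_n)-p(y_n))/‖x_n-y_n‖ → sup{p(x) : ‖x‖ = 1}, then T attains its norm: there exists z ∈ X with ‖z‖ = 1 and ‖Tz‖ = ‖T‖. -/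
open Filter Topology

theorem stmt9 {X Y : Type*} [NormedAddCommGroup X] [NormedSpace ℝ X]
    [CompleteSpace X] [Nontrivial X] [NormedAddCommGroup Y] [NormedSpace ℝ Y]
    (p : X → ℝ) (hhom : ∀ (l : ℝ) (x : X), p (l • x) = |l| * p x)
    (hsub : ∀ x y : X, p (x + y) ≤ p x + p y) (hcont : Continuous p)
    (T : X →L[ℝ] Y) (hpT : ∀ x : X, p x = ‖T x‖)
    (xs ys : ℕ → X) (hne : ∀ n, xs n ≠ ys n)
    (hdir : ∃ u : X, Tendsto (fun n => ‖xs n - ys n‖⁻¹ • (xs n - ys n)) atTop (𝓝 u))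
    (hlim : Tendsto (fun n => (p (xs n) - p (ys n)) / ‖xs n - ys n‖) atTop
      (𝓝 (sSup (p '' {x : X | ‖x‖ = 1})))) :
    ∃ z : X, ‖z‖ = 1 ∧ ‖T z‖ = ‖T‖ := by
  obtain ⟨u, hu⟩ := hdir
  have hpos : ∀ n, 0 < ‖xs n - ys n‖ := fun n => norm_pos_iff.mpr (sub_ne_zero.mpr (hne n))
  have hu1 : ‖u‖ = 1 := by
    refine tendsto_nhds_unique hu.norm (tendsto_const_nhds.congr fun n => ?_)
    rw [norm_smul, norm_inv, norm_norm, inv_mul_cancel₀ (hpos n).ne']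
  have hbdd : BddAbove (p '' {x : X | ‖x‖ = 1}) := by
    refine ⟨‖T‖, ?_⟩
    rintro _ ⟨x, hx, rfl⟩
    rw [hpT]
    exact T.unit_le_opNorm x hx.le
  have hT : ‖T‖ ≤ sSup (p '' {x : X | ‖x‖ = 1}) := by
    refine T.opNorm_le_of_unit_norm ((?_ : 0 ≤ p u).trans (le_csSup hbdd ⟨u, hu1, rfl⟩))
      fun x hx => ?_
    · rw [hpT]
      exact norm_nonneg _
    · rw [← hpT]
      exact le_csSup hbdd ⟨x, hx, rfl⟩
  refine ⟨u, hu1, le_antisymm (T.unit_le_opNorm u hu1.le) (hT.trans ?_)⟩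
  rw [← hpT]
  refine le_of_tendsto_of_tendsto' hlim ((hcont.tendsto u).comp hu) fun n => ?_
  have h := hsub (xs n - ys n) (ys n)
  rw [sub_add_cancel] at h
  rw [Function.comp_apply, hhom, abs_of_pos (inv_pos.mpr (hpos n)), div_eq_inv_mul]
  exact mul_le_mul_of_nonneg_left (by linarith) (inv_pos.mpr (hpos n)).le
end

section
/- Let X be an infinite-dimensional real Banach space. Then there exists a continuous seminorm p on X such that sup{p(x) : ‖x‖ = 1} = 1 but p(x) < 1 for every x ∈ X with ‖x‖ = 1; that is, p does not attain its norm. -/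
open Filter Topology

/-- A sequence of norm-one functionals that is pointwise null gives a continuous seminorm which does
not attain its norm. -/
theorem exists_seminorm_of_weakStar_null {X : Type*} [NormedAddCommGroup X] [NormedSpace ℝ X]
    [Nontrivial X] (h : ℕ → StrongDual ℝ X) (hnorm : ∀ k, ‖h k‖ = 1)
    (hnull : ∀ x, Tendsto (fun k => h k x) atTop (𝓝 0)) :
    ∃ p : X → ℝ, (∀ (l : ℝ) (x : X), p (l • x) = |l| * p x) ∧
      (∀ x y : X, p (x + y) ≤ p x + p y) ∧ Continuous p ∧
      sSup (p '' {x : X | ‖x‖ = 1}) = 1 ∧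
      ∀ x : X, ‖x‖ = 1 → p x < 1 := by
  set w : ℕ → ℝ := fun k => 1 - 1 / ((k : ℝ) + 1) with hw
  have hw0 : ∀ k, 0 ≤ w k := fun k => by
    have : 1 / ((k : ℝ) + 1) ≤ 1 := by
      rw [div_le_one (by positivity)]; linarith [(Nat.cast_nonneg k : (0 : ℝ) ≤ k)]
    simp only [hw]; linarith
  have hw1 : ∀ k, w k < 1 := fun k => by
    have : 0 < 1 / ((k : ℝ) + 1) := by positivity
    simp only [hw]; linarith
  have hle : ∀ k x, w k * |h k x| ≤ ‖x‖ := fun k x => by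
    have h1 : |h k x| ≤ ‖x‖ := by
      have := (h k).le_opNorm x
      rwa [hnorm, one_mul, Real.norm_eq_abs] at this
    nlinarith [hw0 k, hw1 k, abs_nonneg (h k x)]
  have hbdd : ∀ x, BddAbove (Set.range fun k => w k * |h k x|) := fun x =>
    ⟨‖x‖, by rintro _ ⟨k, rfl⟩; exact hle k x⟩
  set p : X → ℝ := fun x => ⨆ k, w k * |h k x| with hp
  have hpk : ∀ k x, w k * |h k x| ≤ p x := fun k x => le_ciSup (hbdd x) k
  have hpn : ∀ x, p x ≤ ‖x‖ := fun x => ciSup_le fun k => hle k x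
  have hadd : ∀ x y, p (x + y) ≤ p x + p y := fun x y => ciSup_le fun k => by
    rw [map_add]
    calc w k * |h k x + h k y| ≤ w k * (|h k x| + |h k y|) :=
          mul_le_mul_of_nonneg_left (abs_add_le _ _) (hw0 k)
      _ ≤ p x + p y := by rw [mul_add]; exact add_le_add (hpk k x) (hpk k y)
  have hlt : ∀ x, ‖x‖ = 1 → p x < 1 := fun x hx => by
    obtain ⟨N, hN⟩ := eventually_atTop.1 ((hnull x).abs.eventually_lt_const
      (u := 1 / 2) (by norm_num))
    have hwN : Monotone w := fun a b hab => by
      have : (a : ℝ) ≤ b := by exact_mod_cast hab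
      have : 1 / ((b : ℝ) + 1) ≤ 1 / ((a : ℝ) + 1) := by gcongr
      simp only [hw]; linarith
    refine lt_of_le_of_lt (ciSup_le fun k => ?_) (max_lt (hw1 N) (by norm_num : (1 / 2 : ℝ) < 1))
    rcases le_total k N with hk | hk
    · refine le_trans ?_ (le_max_left _ _)
      have h1 : |h k x| ≤ 1 := by
        have := (h k).le_opNorm x
        rwa [hnorm, hx, one_mul, Real.norm_eq_abs] at this
      nlinarith [hw0 k, hwN hk]
    · refine le_trans ?_ (le_max_right _ _)
      nlinarith [hw0 k, hw1 k, hN k hk, abs_nonneg (h k x)]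
  refine ⟨p, fun l x => ?_, hadd, ?_, ?_, hlt⟩
  · simp only [hp, Real.mul_iSup_of_nonneg (abs_nonneg l), map_smul, smul_eq_mul, abs_mul]
    exact iSup_congr fun k => by ring
  · refine (LipschitzWith.of_le_add fun x y => ?_).continuous
    have h1 := hadd y (x - y)
    have h2 := hpn (x - y)
    rw [add_sub_cancel] at h1
    rw [dist_eq_norm]
    linarith
  · refine csSup_eq_of_forall_le_of_forall_lt_exists_gt ?_ ?_ ?_
    · obtain ⟨x, hx⟩ := exists_norm_eq X zero_le_one
      exact ⟨_, x, hx, rfl⟩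
    · rintro _ ⟨x, hx, rfl⟩
      exact (hlt x hx).le
    · intro b hb
      have hlim : Tendsto (fun k => w k * w k) atTop (𝓝 1) := by
        have h1 : Tendsto w atTop (𝓝 (1 - 0)) :=
          tendsto_one_div_add_atTop_nhds_zero_nat.const_sub 1
        simpa using h1.mul h1
      obtain ⟨k, hk⟩ := (hlim.eventually_const_lt hb).exists
      by_contra! hcon
      have : ‖h k‖ ≤ w k := by
        refine ContinuousLinearMap.opNorm_le_of_unit_norm (hw0 k) fun x hx => ?_
        by_contra! h3
        rw [Real.norm_eq_abs] at h3
        have h1 := hcon _ ⟨x, hx, rfl⟩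
        have h2 := hpk k x
        nlinarith [hw0 k]
      rw [hnorm] at this
      exact absurd (hw1 k) this.not_gt

/-- The dual of an infinite-dimensional space contains unit vectors annihilating any given
finite-dimensional subspace. -/
theorem exists_norm_one_annihilating {X : Type*} [NormedAddCommGroup X] [NormedSpace ℝ X]
    (hinf : ¬ FiniteDimensional ℝ X) (G : Submodule ℝ X) [FiniteDimensional ℝ G] :
    ∃ f : StrongDual ℝ X, ‖f‖ = 1 ∧ ∀ y ∈ G, f y = 0 := by
  have hG : G ≠ ⊤ := by
    rintro rfl
    exact hinf (Module.Finite.equiv (Submodule.topEquiv (R := ℝ) (M := X)))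
  have : IsClosed (G : Set X) := G.closed_of_finiteDimensional
  obtain ⟨x, hx⟩ : ∃ x, x ∉ G := by
    by_contra! h
    exact hG (Submodule.eq_top_iff'.2 h)
  have hx' : G.mkQ x ≠ 0 := by simpa using hx
  obtain ⟨φ, -, hφ⟩ := exists_dual_vector ℝ (G.mkQ x) (norm_ne_zero_iff.2 hx')
  set f : StrongDual ℝ X := φ.comp G.mkQL with hf
  have hf0 : f ≠ 0 := fun h => by
    have h1 : f x = 0 := by rw [h]; rfl
    have h2 : f x = φ (G.mkQ x) := rfl
    rw [h2, hφ] at h1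
    exact hx' (norm_eq_zero.1 (by exact_mod_cast h1))
  refine ⟨‖f‖⁻¹ • f, ?_, fun y hy => ?_⟩
  · rw [norm_smul, norm_inv, norm_norm, inv_mul_cancel₀ (norm_ne_zero_iff.2 hf0)]
  · have : f y = φ (G.mkQ y) := rfl
    have h0 : G.mkQ y = 0 := by simpa using hy
    simp [this, h0]

/-- A finite-dimensional subspace of the dual is `2`-normed by a finite-dimensional subspace. -/
theorem exists_finiteDimensional_norming {X : Type*} [NormedAddCommGroup X] [NormedSpace ℝ X]
    (F : Submodule ℝ (StrongDual ℝ X)) [FiniteDimensional ℝ F] :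
    ∃ G : Submodule ℝ X, FiniteDimensional ℝ G ∧
      ∀ u ∈ F, ∃ y ∈ G, ‖y‖ ≤ 1 ∧ ‖u‖ / 2 ≤ u y := by
  have : ProperSpace F := FiniteDimensional.proper ℝ F
  have hsph : ∀ v : F, v ∈ Metric.sphere (0 : F) 1 ↔ ‖(v : StrongDual ℝ X)‖ = 1 := fun v => by
    rw [Metric.mem_sphere, Subtype.dist_eq, Submodule.coe_zero, dist_zero_right]
  have hpt : ∀ u : F, ∃ y : X, ‖(u : StrongDual ℝ X)‖ = 1 → ‖y‖ ≤ 1 ∧ 1 / 2 < (u : StrongDual ℝ X) y := by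
    intro u
    by_cases hu : ‖(u : StrongDual ℝ X)‖ = 1
    · have h1 : (1 / 2 : ℝ) < ‖(u : StrongDual ℝ X)‖ := by
        rw [hu]; norm_num
      obtain ⟨y, hy, hy'⟩ := ContinuousLinearMap.exists_lt_apply_of_lt_opNorm _ h1
      rw [Real.norm_eq_abs] at hy'
      rcases lt_abs.1 hy' with h | h
      · exact ⟨y, fun _ => ⟨hy.le, h⟩⟩
      · exact ⟨-y, fun _ => ⟨by rw [norm_neg]; exact hy.le, by rwa [map_neg]⟩⟩
    · exact ⟨0, fun h => absurd h hu⟩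
  choose y hy using hpt
  obtain ⟨t, ht, hcov⟩ := (isCompact_sphere (0 : F) 1).elim_nhds_subcover
    (fun u => {v : F | 1 / 2 < (v : StrongDual ℝ X) (y u)}) (fun u hu => by
      have hc : Continuous fun v : F => (v : StrongDual ℝ X) (y u) := by fun_prop
      exact hc.continuousAt.eventually_const_lt (hy u ((hsph u).1 hu)).2)
  refine ⟨Submodule.span ℝ (y '' t), FiniteDimensional.span_of_finite ℝ (t.finite_toSet.image y),
    fun u hu => ?_⟩
  by_cases hu0 : u = 0
  · exact ⟨0, Submodule.zero_mem _, by simp, by simp [hu0]⟩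
  have hpos : 0 < ‖u‖ := norm_pos_iff.2 hu0
  set v : F := ⟨‖u‖⁻¹ • u, F.smul_mem _ hu⟩ with hv
  have hv1 : v ∈ Metric.sphere (0 : F) 1 := by
    rw [hsph, norm_smul, norm_inv, norm_norm, inv_mul_cancel₀ hpos.ne']
  obtain ⟨z, hz, hvz⟩ := Set.mem_iUnion₂.1 (hcov hv1)
  refine ⟨y z, Submodule.subset_span ⟨z, hz, rfl⟩, (hy z ((hsph z).1 (ht z hz))).1, ?_⟩
  have : 1 / 2 < ‖u‖⁻¹ * u (y z) := hvz
  rw [inv_mul_eq_div, lt_div_iff₀ hpos] at this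
  linarith

/-- A normalized sequence in the dual whose later terms annihilate a subspace norming the span of
the earlier ones. -/
theorem exists_normalized_sequence {X : Type*} [NormedAddCommGroup X] [NormedSpace ℝ X]
    (hinf : ¬ FiniteDimensional ℝ X) :
    ∃ (f : ℕ → StrongDual ℝ X) (F : ℕ → Submodule ℝ (StrongDual ℝ X)) (G : ℕ → Submodule ℝ X),
      Monotone F ∧ (∀ n, ‖f n‖ = 1) ∧ (∀ n, f n ∈ F n) ∧
      (∀ n, ∀ u ∈ F n, ∃ y ∈ G n, ‖y‖ ≤ 1 ∧ ‖u‖ / 2 ≤ u y) ∧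
      ∀ m n, m < n → ∀ y ∈ G m, f n y = 0 := by
  obtain ⟨s, hs, hs'⟩ := exists_seq_of_forall_finset_exists
    (α := StrongDual ℝ X × Submodule ℝ (StrongDual ℝ X) × Submodule ℝ X)
    (fun a => FiniteDimensional ℝ a.2.1 ∧ FiniteDimensional ℝ a.2.2 ∧ ‖a.1‖ = 1 ∧ a.1 ∈ a.2.1 ∧
      ∀ u ∈ a.2.1, ∃ y ∈ a.2.2, ‖y‖ ≤ 1 ∧ ‖u‖ / 2 ≤ u y)
    (fun a b => a.2.1 ≤ b.2.1 ∧ ∀ y ∈ a.2.2, b.1 y = 0) (fun t ht => by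
      have : FiniteDimensional ℝ (t.sup fun a => a.2.2 : Submodule ℝ X) :=
        Module.Finite.iff_fg.2 <| Submodule.fg_finset_sup _ _ fun a ha =>
          Module.Finite.iff_fg.1 (ht a ha).2.1
      have : FiniteDimensional ℝ (t.sup fun a => a.2.1 : Submodule ℝ (StrongDual ℝ X)) :=
        Module.Finite.iff_fg.2 <| Submodule.fg_finset_sup _ _ fun a ha =>
          Module.Finite.iff_fg.1 (ht a ha).1
      obtain ⟨f, hf, hfG⟩ := exists_norm_one_annihilating hinf (t.sup fun a => a.2.2)
      obtain ⟨G, hG, hFG⟩ := exists_finiteDimensional_norming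
        ((t.sup fun a => a.2.1) ⊔ Submodule.span ℝ {f})
      refine ⟨(f, _, G), ⟨inferInstance, hG, hf,
        Submodule.mem_sup_right (Submodule.mem_span_singleton_self f), hFG⟩, fun a ha =>
        ⟨(Finset.le_sup (f := fun a => a.2.1) ha).trans le_sup_left, fun y hy =>
          hfG y ((Finset.le_sup (f := fun a => a.2.2) ha : a.2.2 ≤ _) hy)⟩⟩)
  refine ⟨fun n => (s n).1, fun n => (s n).2.1, fun n => (s n).2.2,
    monotone_nat_of_le_succ fun n => (hs' n (n + 1) n.lt_succ_self).1, fun n => (hs n).2.2.1,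
    fun n => (hs n).2.2.2.1, fun n => (hs n).2.2.2.2, fun m n hmn => (hs' m n hmn).2⟩

/-- A proper, countably generated filter with a basis of convex sets. It plays the role of a
sequence considered up to passing to convex blocks. -/
structure IsConvexFilter {E : Type*} [AddCommGroup E] [Module ℝ E] (l : Filter E) : Prop where
  neBot : l.NeBot
  countable : l.IsCountablyGenerated
  exists_convex : ∀ S ∈ l, ∃ T ∈ l, T ⊆ S ∧ Convex ℝ T

namespace IsConvexFilter

variable {E F : Type*} [AddCommGroup E] [Module ℝ E] [AddCommGroup F] [Module ℝ F]

theorem map {l : Filter E} (hl : IsConvexFilter l) (A : E →ₗ[ℝ] F) :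
    IsConvexFilter (l.map A) := by
  have := hl.neBot
  have := hl.countable
  refine ⟨inferInstance, inferInstance, fun S hS => ?_⟩
  obtain ⟨T, hT, hTS, hTc⟩ := hl.exists_convex _ hS
  exact ⟨A '' T, image_mem_map hT, Set.image_subset_iff.2 hTS, hTc.linear_image A⟩

theorem prod {l : Filter E} {m : Filter F} (hl : IsConvexFilter l) (hm : IsConvexFilter m) :
    IsConvexFilter (l ×ˢ m) := by
  have := hl.neBot
  have := hl.countable
  have := hm.neBot
  have := hm.countable
  refine ⟨inferInstance, inferInstance, fun S hS => ?_⟩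
  obtain ⟨S₁, hS₁, S₂, hS₂, h⟩ := mem_prod_iff.1 hS
  obtain ⟨T₁, hT₁, hTS₁, hc₁⟩ := hl.exists_convex _ hS₁
  obtain ⟨T₂, hT₂, hTS₂, hc₂⟩ := hm.exists_convex _ hS₂
  exact ⟨T₁ ×ˢ T₂, prod_mem_prod hT₁ hT₂, (Set.prod_mono hTS₁ hTS₂).trans h, hc₁.prod hc₂⟩

theorem inf_principal {l : Filter E} (hl : IsConvexFilter l) {K : Set E} (hK : Convex ℝ K)
    (hf : ∃ᶠ e in l, e ∈ K) : IsConvexFilter (l ⊓ 𝓟 K) := by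
  have := hl.countable
  refine ⟨frequently_mem_iff_neBot.1 hf, inferInstance, fun S hS => ?_⟩
  obtain ⟨T, hT, hTS, hc⟩ := hl.exists_convex _ (mem_inf_principal.1 hS)
  exact ⟨T ∩ K, inter_mem_inf hT (mem_principal_self K), fun e he => hTS he.1 he.2, hc.inter hK⟩

theorem iInf {l : ℕ → Filter E} (hl : ∀ n, IsConvexFilter (l n)) (hanti : Antitone l) :
    IsConvexFilter (⨅ n, l n) := by
  have := fun n => (hl n).countable
  have hdir : Directed (· ≥ ·) l := hanti.directed_ge
  refine ⟨iInf_neBot_of_directed' hdir fun n => (hl n).neBot, inferInstance, fun S hS => ?_⟩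
  obtain ⟨n, hn⟩ := (mem_iInf_of_directed hdir _).1 hS
  obtain ⟨T, hT, hTS, hc⟩ := (hl n).exists_convex _ hn
  exact ⟨T, mem_iInf_of_mem n hT, hTS, hc⟩

theorem principal {K : Set E} (hK : Convex ℝ K) (hne : K.Nonempty) : IsConvexFilter (𝓟 K) :=
  ⟨principal_neBot_iff.2 hne, inferInstance, fun _ hS => ⟨K, mem_principal_self K, hS, hK⟩⟩

end IsConvexFilter

section Dual

variable {X : Type*} [NormedAddCommGroup X] [NormedSpace ℝ X]

/-- All points of the unit ball of `X` eventually oscillate by at most `r` along `l`. -/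
def OscLE (l : Filter (StrongDual ℝ X)) (r : ℝ) : Prop :=
  ∀ x : X, ‖x‖ ≤ 1 → ∀ᶠ u in l ×ˢ l, u.1 x - u.2 x ≤ r

/-- Either some finer convex filter has no oscillation, or the oscillation of all finer convex
filters is bounded below. -/
theorem IsConvexFilter.oscillation_dichotomy {L : Filter (StrongDual ℝ X)}
    (hL : IsConvexFilter L) :
    (∃ l ≤ L, IsConvexFilter l ∧ ∀ r > 0, OscLE l r) ∨
      ∃ l ≤ L, IsConvexFilter l ∧ ∃ c > 0, ∀ m ≤ l, IsConvexFilter m → ¬ OscLE m c := by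
  by_contra! hcon
  obtain ⟨h1, h2⟩ := hcon
  have hstep : ∀ (n : ℕ) (l : {l : Filter (StrongDual ℝ X) // l ≤ L ∧ IsConvexFilter l}),
      ∃ m : {l : Filter (StrongDual ℝ X) // l ≤ L ∧ IsConvexFilter l},
        m.1 ≤ l.1 ∧ OscLE m.1 (1 / ((n : ℝ) + 1)) := fun n l => by
    obtain ⟨m, hm, hmc, hosc⟩ := h2 l.1 l.2.1 l.2.2 (1 / ((n : ℝ) + 1)) (by positivity)
    exact ⟨⟨m, hm.trans l.2.1, hmc⟩, hm, hosc⟩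
  choose next hnext hosc using hstep
  let s : ℕ → {l : Filter (StrongDual ℝ X) // l ≤ L ∧ IsConvexFilter l} :=
    fun n => Nat.rec ⟨L, le_rfl, hL⟩ next n
  have hanti : Antitone fun n => (s n).1 := antitone_nat_of_succ_le fun n => hnext n (s n)
  obtain ⟨r, hr, hr'⟩ := h1 (⨅ n, (s n).1) ((iInf_le _ 0).trans (s 0).2.1)
    (IsConvexFilter.iInf (fun n => (s n).2.2) hanti)
  obtain ⟨n, hn⟩ := exists_nat_one_div_lt hr
  refine hr' fun x hx => ?_
  have hle : (⨅ n, (s n).1) ≤ (s (n + 1)).1 := iInf_le _ (n + 1)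
  exact ((hosc n (s n) x hx).filter_mono (prod_mono hle hle)).mono fun u hu => hu.trans hn.le

/-- One step of the Rademacher construction: average the first components, and store half of
their difference as the `k`-th coefficient. -/
noncomputable def rademacherStep (V : Type*) [AddCommGroup V] [Module ℝ V] (k : ℕ) :
    (V × (ℕ → V)) × (V × (ℕ → V)) →ₗ[ℝ] V × (ℕ → V) where
  toFun e := ((1 / 2 : ℝ) • (e.1.1 + e.2.1), fun i =>
    if i < k then (1 / 2 : ℝ) • (e.1.2 i + e.2.2 i) else (1 / 2 : ℝ) • (e.1.1 - e.2.1))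
  map_add' e e' := by
    refine Prod.ext ?_ (funext fun i => ?_)
    · simp only [Prod.fst_add, Prod.snd_add]; module
    · simp only [Prod.fst_add, Prod.snd_add, Pi.add_apply]
      split_ifs <;> module
  map_smul' c e := by
    refine Prod.ext ?_ (funext fun i => ?_)
    · simp only [Prod.smul_fst, Prod.smul_snd, RingHom.id_apply]; module
    · simp only [Prod.smul_fst, Prod.smul_snd, RingHom.id_apply, Pi.smul_apply]
      split_ifs <;> module

/-- The state of the Rademacher construction after `k` steps: averages and coefficients, the latter
large at the points `x i` and satisfying Bessel's inequality. -/
structure IsRademacherFilter (L : Filter (StrongDual ℝ X)) (c : ℝ) (k : ℕ) (x : ℕ → X)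
    (Φ : Filter (StrongDual ℝ X × (ℕ → StrongDual ℝ X))) : Prop where
  convex : IsConvexFilter Φ
  map_fst_le : Φ.map Prod.fst ≤ L
  bessel : ∀ᶠ e in Φ, ∀ z, (e.1 z) ^ 2 + ∑ i ∈ Finset.range k, (e.2 i z) ^ 2 ≤ ‖z‖ ^ 2
  le_apply : ∀ i < k, ∀ᶠ e in Φ, c / 2 ≤ e.2 i (x i)

theorem IsRademacherFilter.exists_succ {L : Filter (StrongDual ℝ X)} (hL : IsConvexFilter L)
    {c : ℝ} (hosc : ∀ m ≤ L, IsConvexFilter m → ¬ OscLE m c) {k : ℕ} {x : ℕ → X}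
    {Φ : Filter (StrongDual ℝ X × (ℕ → StrongDual ℝ X))} (hΦ : IsRademacherFilter L c k x Φ) :
    ∃ y, ‖y‖ ≤ 1 ∧ ∃ Ψ, IsRademacherFilter L c (k + 1) (Function.update x k y) Ψ := by
  have hmap := hΦ.convex.map (LinearMap.fst ℝ (StrongDual ℝ X) (ℕ → StrongDual ℝ X))
  have h := hosc _ hΦ.map_fst_le hmap
  simp only [OscLE, not_forall, not_eventually, not_le] at h
  obtain ⟨y, hy, hfreq⟩ := h
  rw [prod_map_map_eq, frequently_map] at hfreq
  let K : Set ((StrongDual ℝ X × (ℕ → StrongDual ℝ X)) × (StrongDual ℝ X × (ℕ → StrongDual ℝ X))) :=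
    {e | c ≤ e.1.1 y - e.2.1 y}
  have hK : Convex ℝ K := by
    intro e he e' he' a b ha hb hab
    have h1 : c ≤ e.1.1 y - e.2.1 y := he
    have h2 : c ≤ e'.1.1 y - e'.2.1 y := he'
    change c ≤ (a * e.1.1 y + b * e'.1.1 y) - (a * e.2.1 y + b * e'.2.1 y)
    have : c = a * c + b * c := by rw [← add_mul, hab, one_mul]
    nlinarith
  have hKf : ∃ᶠ e in Φ ×ˢ Φ, e ∈ K := hfreq.mono fun e he => le_of_lt he
  have hprod := (hΦ.convex.prod hΦ.convex).inf_principal hK hKf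
  have hfst : Tendsto Prod.fst (Φ ×ˢ Φ ⊓ 𝓟 K) Φ := tendsto_fst.mono_left inf_le_left
  have hsnd : Tendsto Prod.snd (Φ ×ˢ Φ ⊓ 𝓟 K) Φ := tendsto_snd.mono_left inf_le_left
  refine ⟨y, hy, _, hprod.map (rademacherStep (StrongDual ℝ X) k), ?_, ?_, ?_⟩
  · rw [map_map]
    intro S hS
    obtain ⟨T, hT, hTS, hTc⟩ := hL.exists_convex S hS
    have hT' : ∀ᶠ e in Φ, e.1 ∈ T := hΦ.map_fst_le hT
    rw [mem_map]
    filter_upwards [hfst.eventually hT', hsnd.eventually hT'] with e h1 h2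
    refine hTS ?_
    change (1 / 2 : ℝ) • (e.1.1 + e.2.1) ∈ T
    rw [smul_add]
    exact hTc h1 h2 (by norm_num) (by norm_num) (by norm_num)
  · rw [eventually_map]
    filter_upwards [hfst.eventually hΦ.bessel, hsnd.eventually hΦ.bessel] with e h1 h2 z
    have e1 : ((rademacherStep (StrongDual ℝ X) k e).1 z) = (e.1.1 z + e.2.1 z) / 2 := by
      change (1 / 2 : ℝ) * (e.1.1 z + e.2.1 z) = _
      ring
    have e2 : ((rademacherStep (StrongDual ℝ X) k e).2 k z) = (e.1.1 z - e.2.1 z) / 2 := by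
      simp [rademacherStep]
      ring
    have e3 : ∑ i ∈ Finset.range k, ((rademacherStep (StrongDual ℝ X) k e).2 i z) ^ 2 ≤
        ∑ i ∈ Finset.range k, ((e.1.2 i z) ^ 2 / 2 + (e.2.2 i z) ^ 2 / 2) := by
      refine Finset.sum_le_sum fun i hi => ?_
      have : (rademacherStep (StrongDual ℝ X) k e).2 i z = (e.1.2 i z + e.2.2 i z) / 2 := by
        simp [rademacherStep, Finset.mem_range.1 hi]
        ring
      rw [this]
      nlinarith [sq_nonneg (e.1.2 i z - e.2.2 i z)]
    rw [Finset.sum_add_distrib, ← Finset.sum_div, ← Finset.sum_div] at e3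
    rw [Finset.sum_range_succ, e1, e2]
    nlinarith [h1 z, h2 z]
  · intro i hi
    rw [eventually_map]
    rcases Nat.lt_succ_iff_lt_or_eq.1 hi with hi | rfl
    · filter_upwards [hfst.eventually (hΦ.le_apply i hi), hsnd.eventually (hΦ.le_apply i hi)]
        with e h1 h2
      simp [rademacherStep, hi, Function.update_of_ne hi.ne]
      linarith
    · filter_upwards [mem_inf_of_right (mem_principal_self K)] with e he
      have : c ≤ e.1.1 y - e.2.1 y := he
      simp [rademacherStep]
      linarith

theorem exists_ultrafilter_limit (U : Ultrafilter ℕ) (g : ℕ → StrongDual ℝ X)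
    (hg : ∀ᶠ n in U, ‖g n‖ ≤ 1) :
    ∃ u : StrongDual ℝ X, ∀ z, Tendsto (fun n => g n z) U (𝓝 (u z)) := by
  obtain ⟨u, -, hu⟩ := (WeakDual.isCompact_closedBall (0 : StrongDual ℝ X) 1).ultrafilter_le_nhds'
    (U.map fun n => StrongDual.toWeakDual (g n)) (by
      rw [Ultrafilter.mem_map]
      filter_upwards [hg] with n hn
      simpa using hn)
  exact ⟨WeakDual.toStrongDual u, fun z => ((WeakDual.eval_continuous z).tendsto u).comp hu⟩

/-- Persistent oscillation yields a pointwise square-summable sequence of functionals bounded below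
in norm. -/
theorem exists_weakStar_null_of_oscillation {L : Filter (StrongDual ℝ X)} (hL : IsConvexFilter L)
    (hball : ∀ᶠ u in L, ‖u‖ ≤ 1) {c : ℝ}
    (hosc : ∀ m ≤ L, IsConvexFilter m → ¬ OscLE m c) :
    ∃ h : ℕ → StrongDual ℝ X, (∀ n, c / 2 ≤ ‖h n‖) ∧
      ∀ x, Tendsto (fun n => h n x) atTop (𝓝 0) := by
  have hzero : ∃ Φ, IsRademacherFilter L c 0 (0 : ℕ → X) Φ := by
    refine ⟨_, hL.map (LinearMap.inl ℝ (StrongDual ℝ X) (ℕ → StrongDual ℝ X)), ?_, ?_, by simp⟩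
    · rw [map_map]
      exact le_of_eq map_id
    · rw [eventually_map]
      filter_upwards [hball] with u hu z
      have h1 := u.le_of_opNorm_le hu z
      rw [one_mul, Real.norm_eq_abs] at h1
      simpa using sq_le_sq.2 (h1.trans (le_abs_self _))
  have hstep : ∀ (k : ℕ) (x : ℕ → X), ∃ y, ‖y‖ ≤ 1 ∧ ((∃ Φ, IsRademacherFilter L c k x Φ) →
      ∃ Ψ, IsRademacherFilter L c (k + 1) (Function.update x k y) Ψ) := fun k x => by
    by_cases hΦ : ∃ Φ, IsRademacherFilter L c k x Φ
    · obtain ⟨Φ, hΦ⟩ := hΦ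
      obtain ⟨y, hy, hΨ⟩ := hΦ.exists_succ hL hosc
      exact ⟨y, hy, fun _ => hΨ⟩
    · exact ⟨0, by simp, fun h => absurd h hΦ⟩
  choose y hy hstep using hstep
  let s : ℕ → ℕ → X := fun n => Nat.rec 0 (fun k x => Function.update x k (y k x)) n
  have hs : ∀ k, s (k + 1) = Function.update (s k) k (y k (s k)) := fun k => rfl
  have hsΦ : ∀ k, ∃ Φ, IsRademacherFilter L c k (s k) Φ := fun k => by
    induction k with
    | zero => exact hzero
    | succ k ih => exact hstep k _ ih
  have hstable : ∀ i k, i < k → s k i = y i (s i) := fun i k hik => by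
    induction k, hik using Nat.le_induction with
    | base => rw [hs]; simp
    | succ k hk ih => rw [hs, Function.update_of_ne (Nat.lt_of_succ_le hk).ne, ih]
  have hg : ∀ k, ∃ g : ℕ → StrongDual ℝ X,
      (∀ z, ∑ i ∈ Finset.range k, (g i z) ^ 2 ≤ ‖z‖ ^ 2) ∧
      ∀ i < k, c / 2 ≤ g i (y i (s i)) := fun k => by
    obtain ⟨Φ, hΦ⟩ := hsΦ k
    have := hΦ.convex.neBot
    obtain ⟨e, he, he'⟩ := (hΦ.bessel.and
      ((Finset.range k).eventually_all.2 fun i hi =>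
        hΦ.le_apply i (Finset.mem_range.1 hi))).exists
    refine ⟨e.2, fun z => le_trans (le_add_of_nonneg_left (sq_nonneg _)) (he z), fun i hi => ?_⟩
    rw [← hstable i k hi]
    exact he' i (Finset.mem_range.2 hi)
  choose g hbessel hlarge using hg
  have hU : ∀ i, ∀ᶠ k in (hyperfilter ℕ : Filter ℕ), i < k := fun i =>
    Nat.hyperfilter_le_atTop (eventually_gt_atTop i)
  have hlim : ∀ i, ∃ u : StrongDual ℝ X,
      ∀ z, Tendsto (fun k => g k i z) (hyperfilter ℕ) (𝓝 (u z)) := fun i => by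
    refine exists_ultrafilter_limit _ _ ?_
    filter_upwards [hU i] with k hk
    refine ContinuousLinearMap.opNorm_le_bound _ zero_le_one fun z => ?_
    rw [one_mul, Real.norm_eq_abs]
    refine abs_le_of_sq_le_sq ?_ (norm_nonneg z)
    exact (Finset.single_le_sum (f := fun i => (g k i z) ^ 2) (fun _ _ => sq_nonneg _)
      (Finset.mem_range.2 hk)).trans (hbessel k z)
  choose h hh using hlim
  refine ⟨h, fun i => ?_, fun z => ?_⟩
  · have h1 : c / 2 ≤ h i (y i (s i)) :=
      ge_of_tendsto (hh i _) ((hU i).mono fun k hk => hlarge k i hk)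
    have h2 := (h i).le_opNorm_of_le (hy i (s i))
    rw [mul_one, Real.norm_eq_abs] at h2
    exact h1.trans ((le_abs_self _).trans h2)
  · have hsum : Summable fun i => (h i z) ^ 2 := by
      refine summable_of_sum_range_le (c := ‖z‖ ^ 2) (fun _ => sq_nonneg _) fun m => ?_
      refine le_of_tendsto (tendsto_finsetSum _ fun i _ => (hh i z).pow 2) ?_
      filter_upwards [hU m] with k hk
      exact (Finset.sum_le_sum_of_subset_of_nonneg (Finset.range_mono hk.le)
        fun _ _ _ => sq_nonneg _).trans (hbessel k z)
    have h0 := hsum.tendsto_atTop_zero.sqrt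
    simp only [Real.sqrt_sq_eq_abs, Real.sqrt_zero] at h0
    exact (tendsto_zero_iff_abs_tendsto_zero _).2 h0

/-- A separated convex filter without oscillation yields a pointwise null sequence bounded below in
norm. -/
theorem exists_weakStar_null_of_oscLE {l : Filter (StrongDual ℝ X)} (hl : IsConvexFilter l)
    (hosc : ∀ r > 0, OscLE l r) {c : ℝ} (hsep : ∀ᶠ u in l, ∀ᶠ v in l, c ≤ ‖u - v‖) :
    ∃ h : ℕ → StrongDual ℝ X, (∀ n, c ≤ ‖h n‖) ∧
      ∀ x, Tendsto (fun n => h n x) atTop (𝓝 0) := by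
  have := hl.neBot
  have := hl.countable
  obtain ⟨d, hd⟩ := l.exists_seq_tendsto
  obtain ⟨N, hN⟩ := eventually_atTop.1 (hd.eventually hsep)
  have hm : ∀ n, ∃ m ≥ n, c ≤ ‖d (n + N) - d m‖ := fun n =>
    ((eventually_ge_atTop n).and
      (hd.eventually (hN (n + N) (Nat.le_add_left N n)))).exists
  choose m hmn hm using hm
  have hpair : Tendsto (fun n => (d (n + N), d (m n))) atTop (l ×ˢ l) :=
    (hd.comp (tendsto_add_atTop_nat N)).prodMk
      (hd.comp (tendsto_atTop_mono hmn tendsto_id))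
  refine ⟨fun n => d (n + N) - d (m n), hm, fun x => ?_⟩
  rw [Metric.tendsto_nhds]
  intro ε hε
  set t : ℝ := ‖x‖ + 1 with ht
  have htpos : 0 < t := by positivity
  have hunit : ‖t⁻¹ • x‖ ≤ 1 := by
    rw [norm_smul, norm_inv, Real.norm_of_nonneg htpos.le, inv_mul_le_one₀ htpos]
    linarith
  have hr : 0 < ε / 2 / t := by positivity
  have h1 := hpair.eventually (hosc _ hr _ hunit)
  have h2 := hpair.eventually (hosc _ hr (-(t⁻¹ • x)) (by rwa [norm_neg]))
  filter_upwards [h1, h2] with n h1 h2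
  simp only [map_neg, map_smul, smul_eq_mul] at h1 h2
  rw [le_div_iff₀ htpos] at h1 h2
  have e1 : t⁻¹ * d (n + N) x * t = d (n + N) x := by field_simp
  have e2 : t⁻¹ * d (m n) x * t = d (m n) x := by field_simp
  rw [Real.dist_0_eq_abs, sub_apply, abs_lt]
  constructor <;> nlinarith

/-- Either the dual contains a pointwise null normalized sequence, or a separated convex filter
in its unit ball. -/
theorem exists_weakStar_null_or_separated (hinf : ¬ FiniteDimensional ℝ X) :
    (∃ h : ℕ → StrongDual ℝ X, (∀ n, ‖h n‖ = 1) ∧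
      ∀ x, Tendsto (fun n => h n x) atTop (𝓝 0)) ∨
    ∃ L : Filter (StrongDual ℝ X), IsConvexFilter L ∧ (∀ᶠ u in L, ‖u‖ ≤ 1) ∧
      ∃ c > 0, ∀ᶠ u in L, ∀ᶠ v in L, c ≤ ‖u - v‖ := by
  obtain ⟨f, F, G, hF, hf1, hfF, hG, hfG⟩ := exists_normalized_sequence hinf
  by_cases hnull : ∀ x, Tendsto (fun n => f n x) atTop (𝓝 0)
  · exact Or.inl ⟨f, hf1, hnull⟩
  right
  push Not at hnull
  obtain ⟨x, hx⟩ := hnull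
  obtain ⟨ε, hε, hfreq⟩ : ∃ ε > 0, ∃ᶠ n in atTop, ε ≤ |f n x| := by
    by_contra! hcon
    refine hx (Metric.tendsto_nhds.2 fun ε hε => ?_)
    have := hcon ε hε
    simpa only [not_frequently, not_le, Real.dist_0_eq_abs] using this
  let A : ℕ → Set (StrongDual ℝ X) := fun N =>
    {u | (∃ n ≥ N, u = f n ∨ u = -f n) ∧ ε ≤ u x}
  have hAanti : Antitone A := fun M N hMN u ⟨⟨n, hn, hu⟩, hux⟩ => ⟨⟨n, hMN.trans hn, hu⟩, hux⟩
  have hAne : ∀ N, (A N).Nonempty := fun N => by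
    obtain ⟨n, hn, hnN⟩ := (hfreq.and_eventually (eventually_ge_atTop N)).exists
    rcases le_abs.1 hn with h | h
    · exact ⟨f n, ⟨n, hnN, Or.inl rfl⟩, h⟩
    · exact ⟨-f n, ⟨n, hnN, Or.inr rfl⟩, h⟩
  let L : Filter (StrongDual ℝ X) := ⨅ N, 𝓟 (convexHull ℝ (A N))
  have hmem : ∀ N, convexHull ℝ (A N) ∈ L := fun N =>
    mem_iInf_of_mem N (mem_principal_self _)
  have hball : ∀ u ∈ convexHull ℝ (A 0), ‖u‖ ≤ 1 := fun u hu => by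
    have : convexHull ℝ (A 0) ⊆ Metric.closedBall 0 1 :=
      convexHull_min (by rintro _ ⟨⟨n, -, rfl | rfl⟩, -⟩ <;> simp [hf1]) (convex_closedBall 0 1)
    simpa using this hu
  have hlow : ∀ u ∈ convexHull ℝ (A 0), ε ≤ u x := fun u hu => by
    have hc : Convex ℝ {u : StrongDual ℝ X | ε ≤ u x} :=
      convex_halfSpace_ge (𝕜 := ℝ) ⟨fun _ _ => rfl, fun _ _ => rfl⟩ ε
    exact convexHull_min (fun u hu => hu.2) hc hu
  have hspan : ∀ u ∈ convexHull ℝ (A 0), ∃ m, u ∈ F m := fun u hu => by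
    rw [← Submodule.mem_iSup_of_directed F hF.directed_le]
    refine convexHull_min ?_ (⨆ m, F m).convex hu
    rintro _ ⟨⟨n, -, rfl | rfl⟩, -⟩
    · exact Submodule.mem_iSup_of_mem n (hfF n)
    · exact Submodule.mem_iSup_of_mem n ((F n).neg_mem (hfF n))
  have hvanish : ∀ m, ∀ v ∈ convexHull ℝ (A (m + 1)), ∀ y ∈ G m, v y = 0 := fun m v hv y hy => by
    have hc : Convex ℝ {u : StrongDual ℝ X | u y = 0} :=
      convex_hyperplane (𝕜 := ℝ) ⟨fun _ _ => rfl, fun _ _ => rfl⟩ 0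
    refine convexHull_min ?_ hc hv
    rintro _ ⟨⟨n, hn, rfl | rfl⟩, -⟩ <;> simp [hfG m n hn y hy]
  refine ⟨L, IsConvexFilter.iInf
      (fun N => IsConvexFilter.principal (convex_convexHull ℝ _) (hAne N).convexHull)
      fun M N hMN => principal_mono.2 (convexHull_mono (hAanti hMN)),
    mem_of_superset (hmem 0) hball, ε / (2 * (‖x‖ + 1)), by positivity, ?_⟩
  filter_upwards [hmem 0] with u hu
  obtain ⟨m, hm⟩ := hspan u hu
  obtain ⟨y, hyG, hy1, hy⟩ := hG m u hm
  filter_upwards [hmem (m + 1)] with v hv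
  have h1 := (u - v).le_opNorm_of_le hy1
  rw [sub_apply, hvanish m v hv y hyG, sub_zero, mul_one, Real.norm_eq_abs] at h1
  have h2 := u.le_opNorm x
  rw [Real.norm_eq_abs] at h2
  have h3 := hlow u hu
  have h4 : ε ≤ ‖u‖ * (‖x‖ + 1) := by
    nlinarith [le_abs_self (u x), norm_nonneg u]
  have h5 : ε / (2 * (‖x‖ + 1)) ≤ ‖u‖ / 2 := by
    rw [div_le_iff₀ (by positivity)]
    linarith
  linarith [le_abs_self (u y)]

/-- The Josefson-Nissenzweig theorem. -/
theorem exists_weakStar_null_normalized (hinf : ¬ FiniteDimensional ℝ X) :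
    ∃ h : ℕ → StrongDual ℝ X, (∀ n, ‖h n‖ = 1) ∧
      ∀ x, Tendsto (fun n => h n x) atTop (𝓝 0) := by
  rcases exists_weakStar_null_or_separated hinf with h | ⟨L, hL, hball, c, hc, hsep⟩
  · exact h
  obtain ⟨c, hc, h, hh, hnull⟩ : ∃ c > 0, ∃ h : ℕ → StrongDual ℝ X, (∀ n, c ≤ ‖h n‖) ∧
      ∀ x, Tendsto (fun n => h n x) atTop (𝓝 0) := by
    rcases hL.oscillation_dichotomy with ⟨l, hlL, hl, hosc⟩ | ⟨l, hlL, hl, r, hr, hosc⟩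
    · exact ⟨c, hc, exists_weakStar_null_of_oscLE hl hosc
        ((hsep.filter_mono hlL).mono fun u hu => hu.filter_mono hlL)⟩
    · exact ⟨r / 2, half_pos hr,
        exists_weakStar_null_of_oscillation hl (hball.filter_mono hlL) hosc⟩
  have hpos : ∀ n, 0 < ‖h n‖ := fun n => hc.trans_le (hh n)
  refine ⟨fun n => ‖h n‖⁻¹ • h n, fun n => ?_, fun x => ?_⟩
  · rw [norm_smul, norm_inv, norm_norm, inv_mul_cancel₀ (hpos n).ne']
  · refine squeeze_zero_norm (a := fun n => c⁻¹ * |h n x|) (fun n => ?_) ?_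
    · rw [smul_apply, norm_smul, norm_inv, norm_norm, Real.norm_eq_abs]
      exact mul_le_mul_of_nonneg_right (inv_anti₀ hc (hh n)) (abs_nonneg _)
    · simpa using (hnull x).abs.const_mul c⁻¹

end Dual

theorem stmt10 {X : Type*} [NormedAddCommGroup X] [NormedSpace ℝ X]
    [CompleteSpace X] (hinf : ¬ FiniteDimensional ℝ X) :
    ∃ p : X → ℝ, (∀ (l : ℝ) (x : X), p (l • x) = |l| * p x) ∧
      (∀ x y : X, p (x + y) ≤ p x + p y) ∧ Continuous p ∧
      sSup (p '' {x : X | ‖x‖ = 1}) = 1 ∧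
      ∀ x : X, ‖x‖ = 1 → p x < 1 := by
  have : Nontrivial X := by
    by_contra hX
    rw [not_nontrivial_iff_subsingleton] at hX
    exact hinf inferInstance
  obtain ⟨h, hnorm, hnull⟩ := exists_weakStar_null_normalized hinf
  exact exists_seminorm_of_weakStar_null h hnorm hnull
end

section
/- Let X be a real Banach space with X ≠ {0}. If every f ∈ Lip_0(X) attains its norm directionally (i.e. DA(X) = Lip_0(X)), then X is finite-dimensional. -/
open Filter Topology

/-- `g` (with Lipschitz norm `L`) attains its norm at the direction `u`. -/
def AttainsAtDirection {X : Type*} [NormedAddCommGroup X] [NormedSpace ℝ X]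
    (g : X → ℝ) (L : ℝ) (u : X) : Prop :=
  ∃ xs ys : ℕ → X, (∀ n, xs n ≠ ys n) ∧
    Tendsto (fun n => ‖xs n - ys n‖⁻¹ • (xs n - ys n)) atTop (𝓝 u) ∧
    Tendsto (fun n => (g (xs n) - g (ys n)) / ‖xs n - ys n‖) atTop (𝓝 L)

/-- If all the geometric averages `S n + r ^ n * y n - y m` are eventually almost bounded by `A`,
then `S m + r ^ m * y m - y (m + 1)` stays away from `A`. -/
theorem exists_geom_sum_sub_le {y : ℕ → ℝ} {θ A r : ℝ} (hy : ∀ n, |y n| ≤ 1)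
    (hθ : 0 < θ) (hθ1 : θ ≤ 1) (hA : θ ≤ A) (hr : r = θ / 16)
    (h : ∀ n, ∀ᶠ m in atTop, ∑ i ∈ Finset.range n, (1 - r) * r ^ i * y i + r ^ n * y n - y m ≤
      A + θ * r ^ (n + 1) / 2 ^ (n + 2)) :
    ∃ c > 0, ∀ᶠ m in atTop,
      ∑ i ∈ Finset.range m, (1 - r) * r ^ i * y i + r ^ m * y m - y (m + 1) ≤ A - c := by
  set S : ℕ → ℝ := fun n => ∑ i ∈ Finset.range n, (1 - r) * r ^ i * y i with hS
  have hSs : ∀ n, S (n + 1) = S n + (1 - r) * r ^ n * y n := fun n =>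
    Finset.sum_range_succ _ _
  have hr0 : 0 < r := by rw [hr]; positivity
  have hr1 : r < 1 := by rw [hr]; linarith
  have hyl : ∀ n, -1 ≤ y n := fun n => (abs_le.1 (hy n)).1
  have hyu : ∀ n, y n ≤ 1 := fun n => (abs_le.1 (hy n)).2
  obtain ⟨w, hev, hfr⟩ : ∃ w, (∀ δ > 0, ∀ᶠ m in atTop, w - δ < y m) ∧
      ∀ δ > 0, ∃ᶠ m in atTop, y m < w + δ := by
    have hb : IsBoundedUnder (· ≥ ·) atTop y := isBoundedUnder_of ⟨-1, hyl⟩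
    have hc : IsCoboundedUnder (· ≥ ·) atTop y :=
      (isBoundedUnder_of ⟨1, hyu⟩ : IsBoundedUnder (· ≤ ·) atTop y).isCoboundedUnder_ge
    refine ⟨liminf y atTop, fun δ hδ => eventually_lt_of_lt_liminf (by linarith) hb,
      fun δ hδ => frequently_lt_of_liminf_lt hc (by linarith)⟩
  have hw : -1 ≤ w := by
    by_contra! hlt
    obtain ⟨m, hm⟩ := (hfr (-1 - w) (by linarith)).exists
    linarith [hyl m]
  have hG : ∀ n, S n - (1 - r ^ n) * w ≤ A - θ * r ^ n * (1 / 2 + 1 / 2 ^ (n + 1)) := by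
    intro n
    induction n with
    | zero => simp [hS]; linarith
    | succ n ih =>
      have hup : S n + r ^ n * y n - w ≤ A + θ * r ^ (n + 1) / 2 ^ (n + 2) := by
        refine le_of_forall_pos_le_add fun δ hδ => ?_
        obtain ⟨m, hm, hm'⟩ := ((hfr δ hδ).and_eventually (h n)).exists
        change S n + _ - _ ≤ _ at hm'
        linarith
      have h1 := mul_le_mul_of_nonneg_left ih hr0.le
      have h2 := mul_le_mul_of_nonneg_left hup (sub_nonneg.2 hr1.le)
      have e1 : S (n + 1) - (1 - r ^ (n + 1)) * w =
          r * (S n - (1 - r ^ n) * w) + (1 - r) * (S n + r ^ n * y n - w) := by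
        rw [hSs]; ring
      have e3 : (1 - r) * (θ * r ^ (n + 1) / 2 ^ (n + 2)) ≤ θ * r ^ (n + 1) / 2 ^ (n + 2) :=
        mul_le_of_le_one_left (by positivity) (by linarith)
      have e2 : A - θ * r ^ (n + 1) * (1 / 2 + 1 / 2 ^ (n + 1 + 1)) =
          r * (A - θ * r ^ n * (1 / 2 + 1 / 2 ^ (n + 1))) + (1 - r) * A +
            θ * r ^ (n + 1) / 2 ^ (n + 2) := by
        field_simp; ring
      rw [e1, e2]
      linarith
  have hanti : Antitone fun n => S n + r ^ n := antitone_nat_of_succ_le fun n => by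
    have := mul_le_mul_of_nonneg_left (hyu n) (mul_nonneg (sub_nonneg.2 hr1.le) (pow_pos hr0 n).le)
    simp only [hSs]
    rw [pow_succ]
    linarith
  obtain ⟨n, hn⟩ := (hfr (θ / 8) (by positivity)).exists
  have hrn := pow_pos hr0 n
  refine ⟨θ * r ^ n / 8, by positivity, ?_⟩
  filter_upwards [eventually_ge_atTop (n + 1),
    (tendsto_add_atTop_nat 1).eventually (hev (θ * r ^ n / 8) (by positivity))] with m hm hwm
  have h1 : S m + r ^ m ≤ S (n + 1) + r ^ (n + 1) := hanti hm
  have h2 : r ^ m * y m ≤ r ^ m := mul_le_of_le_one_right (pow_pos hr0 m).le (hyu m)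
  have h3 : (1 - r) * r ^ n * y n ≤ (1 - r) * r ^ n * w + r ^ n * (θ / 8) := by
    have a := mul_le_mul_of_nonneg_left hn.le (mul_nonneg (sub_nonneg.2 hr1.le) hrn.le)
    have b : (1 - r) * (r ^ n * (θ / 8)) ≤ r ^ n * (θ / 8) :=
      mul_le_of_le_one_left (by positivity) (by linarith)
    linarith
  have h4 : r ^ (n + 1) * (1 - w) ≤ r ^ n * θ / 8 := by
    have : r ^ (n + 1) * (1 - w) ≤ r ^ (n + 1) * 2 :=
      mul_le_mul_of_nonneg_left (by linarith) (by positivity)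
    rw [pow_succ, hr] at *
    linarith
  have h5 : S n - (1 - r ^ n) * w ≤ A - θ * r ^ n / 2 := by
    have : 0 ≤ θ * r ^ n * (1 / 2 ^ (n + 1)) := by positivity
    linarith [hG n]
  rw [hSs] at h1
  have h6 : r ^ (n + 1) = r * r ^ n := pow_succ' _ _
  change S m + _ - _ ≤ _
  rw [h6] at h1 h4
  linarith

theorem abs_apply_le_norm_of_norm_le_one {X : Type*} [NormedAddCommGroup X]
    [NormedSpace ℝ X] (f : X →L[ℝ] ℝ) {x : X} (hx : ‖x‖ ≤ 1) :
    |f x| ≤ ‖f‖ :=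
  (f.le_opNorm x).trans (mul_le_of_le_one_right (norm_nonneg _) hx)

theorem exists_norm_eq_one_vanishing {X : Type*} [NormedAddCommGroup X] [NormedSpace ℝ X]
    (hX : ¬ FiniteDimensional ℝ X) (T : Finset X) :
    ∃ f : X →L[ℝ] ℝ, ‖f‖ = 1 ∧ ∀ x ∈ T, f x = 0 := by
  set p := Submodule.span ℝ (T : Set X)
  have hp : p ≠ ⊤ := fun h => hX (Module.Finite.of_fg_top ⟨T, h⟩)
  obtain ⟨x, -, hx⟩ := SetLike.exists_of_lt (lt_top_iff_ne_top.2 hp)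
  have hpc : IsClosed (p : Set X) := p.closed_of_finiteDimensional
  have hx0 : ‖p.mkQ x‖ ≠ 0 := by
    simpa [norm_eq_zero] using hx
  obtain ⟨g, -, hg⟩ := exists_dual_vector ℝ (p.mkQ x) hx0
  set f : X →L[ℝ] ℝ := g.comp p.mkQL
  have hf : f x ≠ 0 := by
    change g (p.mkQ x) ≠ 0
    rw [hg]; simpa using hx0
  have hf0 : ‖f‖ ≠ 0 := by
    rw [norm_ne_zero_iff]; rintro h; simp [h] at hf
  refine ⟨‖f‖⁻¹ • f, by simp [norm_smul, hf0], fun y hy => ?_⟩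
  have : p.mkQ y = 0 := by simpa using Submodule.subset_span hy
  have : f y = 0 := by
    change g (p.mkQ y) = 0
    rw [this, map_zero]
  simp [this]

theorem exists_norm_sub_lt_apply {X : Type*} [NormedAddCommGroup X] [NormedSpace ℝ X]
    (g : X →L[ℝ] ℝ) {δ : ℝ} (hδ : 0 < δ) : ∃ x : X, ‖x‖ ≤ 1 ∧ ‖g‖ - δ < g x := by
  by_contra! H
  have h0 : 0 ≤ ‖g‖ - δ := by simpa using H 0 (by simp)
  have : ‖g‖ ≤ ‖g‖ - δ := by
    refine g.opNorm_le_of_unit_norm h0 fun x hx => ?_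
    rw [Real.norm_eq_abs, abs_le]
    have := H (-x) (by simp [hx])
    rw [map_neg] at this
    exact ⟨by linarith, H x hx.le⟩
  linarith

theorem exists_finset_norming {X : Type*} [NormedAddCommGroup X] [NormedSpace ℝ X]
    {C : Set (X →L[ℝ] ℝ)} (hC : IsCompact C) {δ : ℝ} (hδ : 0 < δ) :
    ∃ T : Finset X, ∀ g ∈ C, ∃ x ∈ T, ‖x‖ ≤ 1 ∧ ‖g‖ - δ < g x := by
  obtain ⟨T, hT⟩ := hC.elim_finite_subcover
    (fun x : X => {g : X →L[ℝ] ℝ | ‖x‖ ≤ 1 ∧ ‖g‖ - δ < g x})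
    (fun x => by
      by_cases hx : ‖x‖ ≤ 1
      · simpa [hx] using isOpen_lt (by fun_prop) (by fun_prop)
      · simp [hx])
    (fun g _ => Set.mem_iUnion.2 (exists_norm_sub_lt_apply g hδ))
  refine ⟨T, fun g hg => ?_⟩
  obtain ⟨x, hx, h⟩ := Set.mem_iUnion₂.1 (hT hg)
  exact ⟨x, hx, h⟩

open Classical in
theorem exists_seq_vanishing_norming {X : Type*} [NormedAddCommGroup X] [NormedSpace ℝ X]
    (hX : ¬ FiniteDimensional ℝ X) :
    ∃ f : ℕ → X →L[ℝ] ℝ, (∀ n, ‖f n‖ = 1) ∧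
      ∀ n, ∀ g ∈ convexHull ℝ (f '' Set.Iio n),
        ∃ x : X, ‖x‖ ≤ 1 ∧ ‖g‖ - 1 / ((n : ℝ) + 1) < g x ∧ ∀ i ≥ n, f i x = 0 := by
  choose pick hpick1 hpick0 using exists_norm_eq_one_vanishing hX
  have hT : ∀ (n : ℕ) (s : Finset (X →L[ℝ] ℝ)), ∃ T : Finset X,
      ∀ g ∈ convexHull ℝ (s : Set (X →L[ℝ] ℝ)), ∃ x ∈ T, ‖x‖ ≤ 1 ∧
        ‖g‖ - 1 / ((n : ℝ) + 1) < g x := fun n s =>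
    exists_finset_norming (s.finite_toSet.isCompact_convexHull ℝ) (by positivity)
  choose T hT using hT
  let st : ℕ → Finset (X →L[ℝ] ℝ) × Finset X := fun n => Nat.rec (∅, T 0 ∅)
    (fun n p => (insert (pick p.2) p.1, p.2 ∪ T (n + 1) (insert (pick p.2) p.1))) n
  let f : ℕ → X →L[ℝ] ℝ := fun n => pick (st n).2
  have h1 : ∀ n, (st (n + 1)).1 = insert (f n) (st n).1 := fun n => rfl
  have h2 : ∀ n, (st (n + 1)).2 = (st n).2 ∪ T (n + 1) (st (n + 1)).1 := fun n => rfl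
  have hTn : ∀ n, T n (st n).1 ⊆ (st n).2 := by
    rintro (_ | n)
    · exact subset_rfl
    · rw [h2]; exact Finset.subset_union_right
  have hmono : Monotone fun n => (st n).2 := monotone_nat_of_le_succ fun n => by
    simp only [h2]; exact Finset.subset_union_left
  have hmono1 : Monotone fun n => (st n).1 := monotone_nat_of_le_succ fun n => by
    simp only [h1]; exact Finset.subset_insert _ _
  refine ⟨f, fun n => hpick1 _, fun n g hg => ?_⟩
  have hsub : f '' Set.Iio n ⊆ ((st n).1 : Set (X →L[ℝ] ℝ)) := by
    rintro _ ⟨i, hi, rfl⟩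
    exact hmono1 (Nat.succ_le_of_lt hi) (by simp [h1])
  obtain ⟨x, hx, hx1, hx2⟩ := hT n _ g (convexHull_mono hsub hg)
  exact ⟨x, hx1, hx2, fun i hi => hpick0 _ _ (hmono hi (hTn n hx))⟩

/-- A decreasing sequence of nonempty convex subsets of the unit ball of the dual space. -/
structure ConvexTail (X : Type*) [NormedAddCommGroup X] [NormedSpace ℝ X] where
  carrier : ℕ → Set (X →L[ℝ] ℝ)
  antitone : Antitone carrier
  nonempty : ∀ j, (carrier j).Nonempty
  convex : ∀ j, Convex ℝ (carrier j)
  norm_le : ∀ j, ∀ w ∈ carrier j, ‖w‖ ≤ 1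

/-- Pointwise on the unit ball, `s - w ≤ a` for all `w` far enough in the tail `K`. -/
def ConvexTail.SubLE {X : Type*} [NormedAddCommGroup X] [NormedSpace ℝ X]
    (K : ConvexTail X) (s : X →L[ℝ] ℝ) (a : ℝ) : Prop :=
  ∀ x : X, ‖x‖ ≤ 1 → ∃ j, ∀ w ∈ K.carrier j, (s - w) x ≤ a

/-- The bounds `a` that can be achieved for `s + b • g` by a choice of `g` and a refinement
of `K`. -/
def ConvexTail.levels {X : Type*} [NormedAddCommGroup X] [NormedSpace ℝ X]
    (K : ConvexTail X) (s : X →L[ℝ] ℝ) (b : ℝ) : Set ℝ :=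
  {a | ∃ g ∈ K.carrier 0, ∃ K' : ConvexTail X,
    (∀ j, K'.carrier j ⊆ K.carrier j) ∧ K'.SubLE (s + b • g) a}

namespace ConvexTail

variable {X : Type*} [NormedAddCommGroup X] [NormedSpace ℝ X]

theorem levels_nonempty (K : ConvexTail X) (s : X →L[ℝ] ℝ) (b : ℝ) : (K.levels s b).Nonempty := by
  obtain ⟨g, hg⟩ := K.nonempty 0
  refine ⟨‖s + b • g‖ + 1, g, hg, K, fun j => subset_rfl, fun x hx => ⟨0, fun w hw => ?_⟩⟩
  have h1 := (abs_le.1 (abs_apply_le_norm_of_norm_le_one (s + b • g) hx)).2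
  have h2 := (abs_le.1 ((abs_apply_le_norm_of_norm_le_one w hx).trans (K.norm_le 0 w hw))).1
  rw [sub_apply]
  linarith

theorem nonneg_of_mem_levels {K : ConvexTail X} {s : X →L[ℝ] ℝ} {b a : ℝ}
    (h : a ∈ K.levels s b) : 0 ≤ a := by
  obtain ⟨g, -, K', -, h⟩ := h
  obtain ⟨j, hj⟩ := h 0 (by simp)
  obtain ⟨w, hw⟩ := K'.nonempty j
  simpa using hj w hw

theorem bddBelow_levels (K : ConvexTail X) (s : X →L[ℝ] ℝ) (b : ℝ) : BddBelow (K.levels s b) :=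
  ⟨0, fun _ => nonneg_of_mem_levels⟩

theorem levels_subset {K K' : ConvexTail X} (hK : ∀ j, K'.carrier j ⊆ K.carrier j)
    {s g : X →L[ℝ] ℝ} (hg : g ∈ K.carrier 0) {b c : ℝ} (hb : 0 ≤ b) (hc : 0 < c) :
    K'.levels (s + b • g) c ⊆ K.levels s (b + c) := by
  rintro a ⟨g', hg', K'', hK'', h⟩
  have hbc : b + c ≠ 0 := by positivity
  refine ⟨(b / (b + c)) • g + (c / (b + c)) • g',
    K.convex 0 hg (hK 0 hg') (by positivity) (by positivity) (by field_simp), K'',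
    fun j => (hK'' j).trans (hK j), ?_⟩
  have : s + (b + c) • ((b / (b + c)) • g + (c / (b + c)) • g') = s + b • g + c • g' := by
    rw [smul_add, smul_smul, smul_smul, mul_div_cancel₀ _ hbc, mul_div_cancel₀ _ hbc, add_assoc]
  rwa [this]

theorem exists_refinement (K : ConvexTail X) (s : X →L[ℝ] ℝ) (b : ℝ) {ε : ℝ} (hε : 0 < ε) :
    ∃ g ∈ K.carrier 0, ∃ K' : ConvexTail X, (∀ j, K'.carrier j ⊆ K.carrier (j + 1)) ∧
      K'.SubLE (s + b • g) (sInf (K.levels s b) + ε) ∧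
      ∃ x : X, ‖x‖ ≤ 1 ∧
        ∀ w ∈ K'.carrier 0, sInf (K.levels s b) - ε < (s + b • g - w) x := by
  obtain ⟨a, ⟨g, hg, K', hK', h⟩, ha⟩ :=
    exists_lt_of_csInf_lt (K.levels_nonempty s b) (lt_add_of_pos_right _ hε)
  have hlow : ¬ K'.SubLE (s + b • g) (sInf (K.levels s b) - ε) := fun hle => by
    have := csInf_le (K.bddBelow_levels s b) ⟨g, hg, K', hK', hle⟩
    linarith
  simp only [SubLE, not_forall, not_exists, not_le] at hlow
  obtain ⟨x, hx, hlow⟩ := hlow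
  refine ⟨g, hg, ⟨fun j => {w ∈ K'.carrier (j + 1) |
      sInf (K.levels s b) - ε < (s + b • g - w) x}, ?_, ?_, ?_, ?_⟩, ?_, ?_, x, hx, ?_⟩
  · exact fun i j hij w hw => ⟨K'.antitone (Nat.succ_le_succ hij) hw.1, hw.2⟩
  · intro j
    obtain ⟨w, hw, hwx⟩ := hlow (j + 1)
    exact ⟨w, hw, hwx⟩
  · rintro j v ⟨hv, hvx⟩ w ⟨hw, hwx⟩ p q hp hq hpq
    refine ⟨K'.convex _ hv hw hp hq hpq, ?_⟩
    simp only [sub_apply, add_apply,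
      smul_apply, smul_eq_mul] at hvx hwx ⊢
    have := convex_Iio (𝕜 := ℝ) (s x + b * g x - (sInf (K.levels s b) - ε))
      (show v x ∈ _ by simp only [Set.mem_Iio]; linarith)
      (show w x ∈ _ by simp only [Set.mem_Iio]; linarith) hp hq hpq
    simp only [Set.mem_Iio, smul_eq_mul] at this
    linarith
  · exact fun j w hw => K'.norm_le _ w hw.1
  · exact fun j w hw => hK' _ hw.1
  · intro z hz
    obtain ⟨j, hj⟩ := h z hz
    exact ⟨j, fun w hw => (hj w (K'.antitone (Nat.le_succ j) hw.1)).trans ha.le⟩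
  · exact fun w hw => hw.2

/-- Successive near-minimization of the bounds in `levels` along the weights
`(1 - r) * r ^ i`, as in James's proof of his theorem on norm-attaining functionals. -/
theorem exists_optimizing_seq (K : ConvexTail X) {r : ℝ} (hr0 : 0 < r) (hr1 : r < 1) {ε : ℕ → ℝ}
    (hε : ∀ n, 0 < ε n) :
    ∃ (g : ℕ → X →L[ℝ] ℝ) (s : ℕ → X →L[ℝ] ℝ) (α : ℕ → ℝ), Monotone α ∧
      α 0 = sInf (K.levels 0 1) ∧ (∀ n, ‖g n‖ ≤ 1) ∧
      (∀ n, s n = ∑ i ∈ Finset.range n, ((1 - r) * r ^ i) • g i) ∧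
      (∀ n (x : X), ‖x‖ ≤ 1 → ∀ᶠ m in atTop, (s n + r ^ n • g n - g m) x ≤ α n + ε n) ∧
      ∀ n, ∃ x : X, ‖x‖ ≤ 1 ∧ ∀ m > n, α n - ε n < (s n + r ^ n • g n - g m) x := by
  choose G hG T hT hle hlt using fun (n : ℕ) (p : (X →L[ℝ] ℝ) × ConvexTail X) =>
    p.2.exists_refinement p.1 (r ^ n) (hε n)
  let st : ℕ → (X →L[ℝ] ℝ) × ConvexTail X := fun n =>
    Nat.rec (0, K) (fun n p => (p.1 + ((1 - r) * r ^ n) • G n p, T n p)) n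
  let g : ℕ → X →L[ℝ] ℝ := fun n => G n (st n)
  have h1 : ∀ n, (st (n + 1)).1 = (st n).1 + ((1 - r) * r ^ n) • g n := fun n => rfl
  have h2 : ∀ n, (st (n + 1)).2 = T n (st n) := fun n => rfl
  have hsub : ∀ n j, (st (n + 1)).2.carrier j ⊆ (st n).2.carrier (j + 1) := fun n => hT n (st n)
  have hshift : ∀ n k, (st (n + k)).2.carrier 0 ⊆ (st n).2.carrier k := by
    intro n k
    suffices ∀ j, (st (n + k)).2.carrier j ⊆ (st n).2.carrier (j + k) by simpa using this 0
    induction k with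
    | zero => exact fun j => subset_rfl
    | succ k ih =>
      intro j
      refine (hsub (n + k) j).trans ((ih (j + 1)).trans ?_)
      rw [add_right_comm, add_assoc]
  have hgm : ∀ n, g n ∈ (st n).2.carrier 0 := fun n => hG n (st n)
  refine ⟨g, fun n => (st n).1, fun n => sInf ((st n).2.levels (st n).1 (r ^ n)), ?_, ?_, ?_, ?_,
    ?_, ?_⟩
  · refine monotone_nat_of_le_succ fun n => ?_
    refine csInf_le_csInf (bddBelow_levels _ _ _) (levels_nonempty _ _ _) ?_
    have := levels_subset (s := (st n).1) (K := (st n).2) (K' := (st (n + 1)).2)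
      (fun j => (hsub n j).trans ((st n).2.antitone (Nat.le_succ j))) (hgm n)
      (b := (1 - r) * r ^ n) (c := r ^ (n + 1))
      (mul_nonneg (by linarith) (by positivity)) (by positivity)
    rw [h1]
    convert this using 2
    ring
  · change sInf (K.levels 0 (r ^ 0)) = _
    rw [pow_zero]
  · exact fun n => (st n).2.norm_le 0 _ (hgm n)
  · intro n
    induction n with
    | zero => rfl
    | succ n ih => rw [Finset.sum_range_succ, ← ih]
  · intro n x hx
    obtain ⟨j, hj⟩ := hle n (st n) x hx
    filter_upwards [eventually_ge_atTop (n + 1 + j)] with m hm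
    obtain ⟨k, rfl⟩ := Nat.exists_eq_add_of_le hm
    refine hj _ ((T n (st n)).antitone (Nat.le_add_right j k) ?_)
    have := hshift (n + 1) (j + k)
    rw [← add_assoc] at this
    exact this (hgm _)
  · intro n
    obtain ⟨x, hx, h⟩ := hlt n (st n)
    refine ⟨x, hx, fun m hm => ?_⟩
    obtain ⟨k, rfl⟩ := Nat.exists_eq_add_of_le (Nat.succ_le_of_lt hm)
    exact h _ ((T n (st n)).antitone (Nat.zero_le k) (hshift (n + 1) k (hgm _)))

theorem exists_seq_apply_le_sub (K : ConvexTail X) {θ : ℝ} (hθ : 0 < θ) (hθ1 : θ ≤ 1)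
    (hK : ∀ g ∈ K.carrier 0, ∃ x : X, ‖x‖ ≤ 1 ∧ ∃ j, ∀ w ∈ K.carrier j, θ ≤ (g - w) x) :
    ∃ A > 0, ∃ h : ℕ → X →L[ℝ] ℝ, (∀ δ > 0, ∀ᶠ m in atTop, A - δ < ‖h m‖) ∧
      ∀ u : X, ‖u‖ ≤ 1 → ∃ c > 0, ∀ᶠ m in atTop, h m u ≤ A - c := by
  obtain ⟨r, hr⟩ : ∃ r, r = θ / 16 := ⟨_, rfl⟩
  have hr0 : 0 < r := by rw [hr]; positivity
  have hr1 : r < 1 := by rw [hr]; linarith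
  set ε : ℕ → ℝ := fun n => θ * r ^ (n + 1) / 2 ^ (n + 2)
  have hε : ∀ n, 0 < ε n := fun n => by positivity
  have hεr : ∀ n, ε n ≤ r ^ n := fun n => by
    have h1 : θ * r ^ (n + 1) ≤ r ^ n := by
      rw [pow_succ, mul_left_comm]
      exact mul_le_of_le_one_right (by positivity) (mul_le_one₀ hθ1 hr0.le hr1.le)
    exact (div_le_self (by positivity) (one_le_pow₀ one_le_two)).trans h1
  obtain ⟨g, s, α, hα, hα0, hg, hs, hup, hlow⟩ := K.exists_optimizing_seq hr0 hr1 hε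
  have hθα : θ ≤ α 0 := by
    rw [hα0]
    refine le_csInf (levels_nonempty _ _ _) ?_
    rintro a ⟨f, hf, K', hK', ha⟩
    obtain ⟨x, hx, j, hj⟩ := hK f hf
    obtain ⟨i, hi⟩ := ha x hx
    obtain ⟨w, hw⟩ := K'.nonempty (max i j)
    have h1 := hi w (K'.antitone (le_max_left i j) hw)
    have h2 := hj w (hK' _ (K'.antitone (le_max_right i j) hw))
    simp only [zero_add, one_smul] at h1
    exact h2.trans h1
  have hsn : ∀ n, ‖s n‖ ≤ 1 - r ^ n := by
    intro n
    induction n with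
    | zero => simp [hs]
    | succ n ih =>
      have h1 : s (n + 1) = s n + ((1 - r) * r ^ n) • g n := by
        rw [hs, hs, Finset.sum_range_succ]
      have h0 : 0 ≤ (1 - r) * r ^ n := mul_nonneg (by linarith) (by positivity)
      have h2 : ‖((1 - r) * r ^ n) • g n‖ ≤ (1 - r) * r ^ n := by
        rw [norm_smul, Real.norm_of_nonneg h0]
        exact mul_le_of_le_one_right h0 (hg n)
      rw [h1]
      calc _ ≤ ‖s n‖ + ‖((1 - r) * r ^ n) • g n‖ := norm_add_le _ _
        _ ≤ (1 - r ^ n) + (1 - r) * r ^ n := add_le_add ih h2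
        _ = 1 - r ^ (n + 1) := by ring
  set h : ℕ → X →L[ℝ] ℝ := fun m => s m + r ^ m • g m - g (m + 1)
  have hh : ∀ m, α m - ε m < ‖h m‖ := fun m => by
    obtain ⟨x, hx, hm⟩ := hlow m
    exact (hm _ (Nat.lt_succ_self m)).trans_le
      ((le_abs_self _).trans (abs_apply_le_norm_of_norm_le_one _ hx))
  have hbdd : BddAbove (Set.range α) := by
    refine ⟨3, ?_⟩
    rintro _ ⟨m, rfl⟩
    have h1 : ‖h m‖ ≤ ‖s m‖ + ‖r ^ m • g m‖ + ‖g (m + 1)‖ :=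
      (norm_sub_le _ _).trans (add_le_add_left (norm_add_le _ _) _)
    have h2 : ‖r ^ m • g m‖ ≤ r ^ m := by
      rw [norm_smul, Real.norm_of_nonneg (by positivity)]
      exact mul_le_of_le_one_right (by positivity) (hg m)
    have h3 : r ^ m ≤ 1 := pow_le_one₀ hr0.le hr1.le
    linarith [hh m, hg (m + 1), hsn m, hεr m]
  have hθA : θ ≤ ⨆ n, α n := hθα.trans (le_ciSup hbdd 0)
  refine ⟨⨆ n, α n, hθ.trans_le hθA, h, fun δ hδ => ?_, fun u hu => ?_⟩
  · have h1 : ∀ᶠ m in atTop, (⨆ n, α n) - δ / 2 < α m :=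
      (tendsto_atTop_ciSup hα hbdd).eventually (lt_mem_nhds (by linarith))
    have h2 : ∀ᶠ m in atTop, r ^ m < δ / 2 :=
      (tendsto_pow_atTop_nhds_zero_of_lt_one hr0.le hr1).eventually (gt_mem_nhds (by linarith))
    filter_upwards [h1, h2] with m h1 h2
    linarith [hh m, hεr m]
  · have hsu : ∀ n, s n u = ∑ i ∈ Finset.range n, (1 - r) * r ^ i * g i u := fun n => by
      simp [hs]
    obtain ⟨c, hc, H⟩ := exists_geom_sum_sub_le (y := fun n => g n u) (A := ⨆ n, α n)
      (fun n => (abs_apply_le_norm_of_norm_le_one (g n) hu).trans (hg n)) hθ hθ1 hθA hr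
      (fun n => by
        filter_upwards [hup n u hu] with m hm
        refine le_trans ?_ (hm.trans (add_le_add_left (le_ciSup hbdd n) _))
        simp [hsu])
    refine ⟨c, hc, ?_⟩
    filter_upwards [H] with m hm
    simpa [h, hsu] using hm

end ConvexTail

theorem exists_seq_apply_le_sub_of_infiniteDimensional
    {X : Type*} [NormedAddCommGroup X] [NormedSpace ℝ X]
    (hX : ¬ FiniteDimensional ℝ X) :
    ∃ A > 0, ∃ h : ℕ → X →L[ℝ] ℝ, (∀ δ > 0, ∀ᶠ m in atTop, A - δ < ‖h m‖) ∧
      ∀ u : X, ‖u‖ ≤ 1 → ∃ c > 0, ∀ᶠ m in atTop, h m u ≤ A - c := by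
  obtain ⟨f, hf1, hf⟩ := exists_seq_vanishing_norming hX
  by_cases hnull : ∀ u : X, ‖u‖ ≤ 1 → ∀ ε > 0, ∀ᶠ n in atTop, f n u < ε
  · refine ⟨1, one_pos, f, fun δ hδ => .of_forall fun m => by rw [hf1]; linarith, fun u hu =>
      ⟨1 / 2, by norm_num, ?_⟩⟩
    filter_upwards [hnull u hu (1 / 2) (by norm_num)] with m hm
    linarith
  · push Not at hnull
    obtain ⟨u, hu, ε, hε, hfr⟩ := hnull
    obtain ⟨φ, hφ, hφu⟩ := extraction_of_frequently_atTop hfr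
    let K : ConvexTail X :=
      { carrier := fun j => convexHull ℝ ((fun i => f (φ i)) '' Set.Ici j)
        antitone := fun i j hij => convexHull_mono (Set.image_mono (Set.Ici_subset_Ici.2 hij))
        nonempty := fun j => ⟨f (φ j), subset_convexHull ℝ _ ⟨j, Set.self_mem_Ici, rfl⟩⟩
        convex := fun j => convex_convexHull ℝ _
        norm_le := fun j w hw => by
          have : convexHull ℝ ((fun i => f (φ i)) '' Set.Ici j) ⊆ Metric.closedBall 0 1 :=
            convexHull_min (by rintro _ ⟨i, -, rfl⟩; simp [hf1]) (convex_closedBall 0 1)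
          simpa using this hw }
    have hε1 : ε ≤ 1 := by
      have := abs_apply_le_norm_of_norm_le_one (f (φ 0)) hu
      rw [hf1] at this
      exact (hφu 0).trans ((le_abs_self _).trans this)
    refine K.exists_seq_apply_le_sub (half_pos hε) (by linarith) fun g hg => ?_
    have hgu : ε ≤ g u := by
      have : K.carrier 0 ⊆ {w : X →L[ℝ] ℝ | ε ≤ w u} :=
        convexHull_min (by rintro _ ⟨i, -, rfl⟩; exact hφu i)
          (convex_halfSpace_ge ⟨fun _ _ => rfl, fun _ _ => rfl⟩ ε)
      exact this hg
    have hgn : ε ≤ ‖g‖ :=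
      hgu.trans ((le_abs_self _).trans (abs_apply_le_norm_of_norm_le_one g hu))
    have hmono : Monotone fun n => convexHull ℝ (f '' Set.Iio n) := fun m n hmn =>
      convexHull_mono (Set.image_mono (Set.Iio_subset_Iio hmn))
    obtain ⟨N, hN⟩ : ∃ N, g ∈ convexHull ℝ (f '' Set.Iio N) := by
      have : K.carrier 0 ⊆ ⋃ n, convexHull ℝ (f '' Set.Iio n) := by
        refine convexHull_min ?_
          (hmono.directed_le.convex_iUnion fun n => convex_convexHull ℝ _)
        rintro _ ⟨i, -, rfl⟩
        exact Set.mem_iUnion.2 ⟨φ i + 1, subset_convexHull ℝ _ ⟨φ i, Nat.lt_succ_self _, rfl⟩⟩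
      exact Set.mem_iUnion.1 (this hg)
    obtain ⟨M, hM⟩ := exists_nat_one_div_lt (half_pos hε)
    obtain ⟨x, hx, hxg, hx0⟩ := hf (max N M) g (hmono (le_max_left N M) hN)
    refine ⟨x, hx, max N M, fun w hw => ?_⟩
    have hw0 : w x = 0 := by
      have : K.carrier (max N M) ⊆ {w : X →L[ℝ] ℝ | w x = 0} :=
        convexHull_min
          (by rintro _ ⟨i, hi, rfl⟩; exact hx0 _ (le_trans hi (hφ.le_apply)))
          (convex_hyperplane ⟨fun _ _ => rfl, fun _ _ => rfl⟩ 0)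
      exact this hw
    have hMle : 1 / (((max N M : ℕ) : ℝ) + 1) ≤ 1 / ((M : ℝ) + 1) :=
      Nat.one_div_le_one_div (le_max_right N M)
    rw [sub_apply, hw0]
    linarith

theorem exists_seq_norm_le_one_apply_le {X : Type*} [NormedAddCommGroup X] [NormedSpace ℝ X]
    (hX : ¬ FiniteDimensional ℝ X) :
    ∃ k : ℕ → X →L[ℝ] ℝ, (∀ m, ‖k m‖ ≤ 1) ∧ (∀ ε > 0, ∃ m, 1 - ε < ‖k m‖) ∧
      ∀ u : X, ‖u‖ ≤ 1 → ∃ c < 1, ∀ m, k m u ≤ c := by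
  obtain ⟨A, hA, h, hn, hu⟩ := exists_seq_apply_le_sub_of_infiniteDimensional hX
  have hpos : ∀ᶠ m in atTop, 0 < ‖h m‖ := by simpa using hn A hA
  have ht : ∀ m : ℕ, 0 ≤ 1 - 1 / ((m : ℝ) + 1) := fun m =>
    sub_nonneg.2 ((div_le_one (by positivity)).2 (by simp))
  have ht1 : ∀ m : ℕ, 1 - 1 / ((m : ℝ) + 1) < 1 := fun m => sub_lt_self _ (by positivity)
  have hle : ∀ m, ‖‖h m‖⁻¹ • h m‖ ≤ 1 := fun m => by
    rw [norm_smul, norm_inv, norm_norm]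
    exact inv_mul_le_one
  refine ⟨fun m => (1 - 1 / ((m : ℝ) + 1)) • ‖h m‖⁻¹ • h m, fun m => ?_, fun ε hε => ?_,
    fun u hu1 => ?_⟩
  · rw [norm_smul, Real.norm_of_nonneg (ht m)]
    exact mul_le_one₀ (ht1 m).le (norm_nonneg _) (hle m)
  · obtain ⟨m, hm, hmε⟩ := (hpos.and
      (tendsto_one_div_add_atTop_nhds_zero_nat.eventually (gt_mem_nhds hε))).exists
    refine ⟨m, ?_⟩
    rw [norm_smul, norm_smul, norm_inv, norm_norm, inv_mul_cancel₀ hm.ne',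
      Real.norm_of_nonneg (ht m)]
    linarith
  · obtain ⟨c, hc, hev⟩ := hu u hu1
    obtain ⟨M, hM⟩ := eventually_atTop.1 ((hev.and hpos).and (hn (c / 2) (half_pos hc)))
    have habs : ∀ m, (‖h m‖⁻¹ • h m) u ≤ 1 := fun m =>
      (le_abs_self _).trans ((abs_apply_le_norm_of_norm_le_one _ hu1).trans (hle m))
    set d := max 0 (1 - c / 2 / A)
    refine ⟨max d (1 - 1 / ((M : ℝ) + 1)), max_lt (max_lt one_pos (sub_lt_self _ (by positivity)))
      (ht1 M), fun m => ?_⟩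
    rw [smul_apply, smul_eq_mul]
    rcases le_total M m with hm | hm
    · obtain ⟨⟨h1, h2⟩, h3⟩ := hM m hm
      have h4 : (‖h m‖⁻¹ • h m) u ≤ d := by
        rw [smul_apply, smul_eq_mul, inv_mul_le_iff₀ h2]
        rcases le_total (A - c) 0 with h5 | h5
        · exact (h1.trans h5).trans (mul_nonneg h2.le (le_max_left _ _))
        · have h6 : A - c ≤ (A - c / 2) * (1 - c / 2 / A) := by
            have : (A - c / 2) * (1 - c / 2 / A) = A - c + (c / 2) ^ 2 / A := by
              field_simp; ring
            rw [this]
            have : 0 ≤ (c / 2) ^ 2 / A := by positivity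
            linarith
          exact h1.trans (h6.trans ((mul_le_mul_of_nonneg_left (le_max_right _ _)
            (by linarith)).trans (mul_le_mul_of_nonneg_right h3.le (le_max_left _ _))))
      refine le_trans ?_ (le_max_left _ _)
      exact (mul_le_mul_of_nonneg_left h4 (ht m)).trans
        (mul_le_of_le_one_left (le_max_left _ _) (ht1 m).le)
    · refine le_trans ?_ (le_max_right _ _)
      have := Nat.one_div_le_one_div (α := ℝ) hm
      exact (mul_le_of_le_one_right (ht m) (habs m)).trans (by linarith)

/-- The functional `k`, clipped between `-a` and `a` for the tent function
`a z = max 0 (1 - ‖z‖ / 2)`. -/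
noncomputable def clippedFunctional {X : Type*} [NormedAddCommGroup X] [NormedSpace ℝ X]
    (k : X →L[ℝ] ℝ) (z : X) : ℝ :=
  max (-max 0 (1 - ‖z‖ / 2)) (min (k z) (max 0 (1 - ‖z‖ / 2)))

section clippedFunctional

variable {X : Type*} [NormedAddCommGroup X] [NormedSpace ℝ X]

theorem abs_clippedFunctional_le_one (k : X →L[ℝ] ℝ) (z : X) : |clippedFunctional k z| ≤ 1 := by
  have h0 : 0 ≤ max 0 (1 - ‖z‖ / 2) := le_max_left _ _
  have h1 : max 0 (1 - ‖z‖ / 2) ≤ 1 := max_le zero_le_one (by linarith [norm_nonneg z])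
  refine abs_le.2 ⟨(neg_le_neg h1).trans (le_max_left _ _), max_le (by linarith) ?_⟩
  exact (min_le_right _ _).trans h1

theorem clippedFunctional_eq_zero (k : X →L[ℝ] ℝ) {z : X} (hz : 2 ≤ ‖z‖) :
    clippedFunctional k z = 0 := by
  have h : max 0 (1 - ‖z‖ / 2) = 0 := max_eq_left (by linarith)
  simp [clippedFunctional, h]

theorem clippedFunctional_eq_apply {k : X →L[ℝ] ℝ} (hk : ‖k‖ ≤ 1) {z : X} (hz : ‖z‖ ≤ 1 / 2) :
    clippedFunctional k z = k z := by
  have h : max 0 (1 - ‖z‖ / 2) = 1 - ‖z‖ / 2 := max_eq_right (by linarith)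
  have hkz := abs_le.1 ((k.le_opNorm z).trans (mul_le_of_le_one_left (norm_nonneg z) hk))
  rw [clippedFunctional, h, min_eq_left (by linarith), max_eq_right (by linarith)]

theorem abs_clippedFunctional_sub_le (k : X →L[ℝ] ℝ) (z w : X) :
    |clippedFunctional k z - clippedFunctional k w| ≤ max |k (z - w)| (‖z - w‖ / 2) := by
  have h : |max 0 (1 - ‖z‖ / 2) - max 0 (1 - ‖w‖ / 2)| ≤ ‖z - w‖ / 2 := by
    refine (abs_max_sub_max_le_max _ _ _ _).trans (max_le (by simp; positivity) ?_)
    have := abs_norm_sub_norm_le w z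
    rw [norm_sub_rev] at this
    calc _ = |(‖w‖ - ‖z‖) / 2| := by congr 1; ring
      _ ≤ _ := by rw [abs_div, abs_two]; linarith
  refine (abs_max_sub_max_le_max _ _ _ _).trans (max_le (le_max_of_le_right ?_) ?_)
  · rwa [neg_sub_neg, abs_sub_comm]
  · rw [map_sub]
    exact (abs_min_sub_min_le_max _ _ _ _).trans (max_le_max le_rfl h)

theorem exists_piecewise_clippedFunctional [Nontrivial X] {k : ℕ → X →L[ℝ] ℝ}
    (hk : ∀ m, ‖k m‖ ≤ 1) :
    ∃ g : X → ℝ, g 0 = 0 ∧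
      (∀ x y, ∃ m, |g x - g y| ≤ max |k m (x - y)| (‖x - y‖ / 2)) ∧
      ∀ m, ∃ p, ∀ z, ‖z‖ ≤ 1 / 2 → g (p + z) - g p = k m z := by
  obtain ⟨e, he⟩ := exists_norm_eq X (zero_le_one (α := ℝ))
  let p : ℕ → X := fun m => (8 * (m : ℝ)) • e
  have hp : ∀ m n, m ≠ n → 8 ≤ ‖p m - p n‖ := by
    intro m n hmn
    rw [← sub_smul, norm_smul, he, mul_one, ← mul_sub, Real.norm_eq_abs, abs_mul]
    have : (1 : ℝ) ≤ |(m : ℝ) - n| := by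
      exact_mod_cast Int.one_le_abs (sub_ne_zero.2 (Int.natCast_inj.not.2 hmn))
    rw [abs_of_pos (by norm_num : (0 : ℝ) < 8)]
    linarith
  let F : ℕ → X → ℝ := fun m x => clippedFunctional (k m) (x - p m)
  let g : X → ℝ := fun x => ∑' m, F m x
  have hzero : ∀ m x, 2 ≤ ‖x - p m‖ → F m x = 0 := fun m x => clippedFunctional_eq_zero _
  have hfar : ∀ m n x y, m ≠ n → ‖x - p m‖ < 2 → ‖y - p n‖ < 2 → 4 ≤ ‖x - y‖ := by
    intro m n x y hmn hx hy
    have : p m - p n = -(x - p m) + (x - y) + (y - p n) := by abel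
    have h := norm_add₃_le (a := -(x - p m)) (b := x - y) (c := y - p n)
    rw [← this, norm_neg] at h
    linarith [hp m n hmn]
  have hg1 : ∀ m x, ‖x - p m‖ < 2 → g x = F m x := fun m x hx =>
    tsum_eq_single m fun n hn => hzero n x <| by
      by_contra! hlt
      have := hfar m n x x hn.symm hx hlt
      norm_num at this
  have hg0 : ∀ x, (∀ m, 2 ≤ ‖x - p m‖) → g x = 0 := fun x hx => by
    simp [g, fun m => hzero m x (hx m)]
  have hsame : ∀ m x y, g x = F m x → g y = F m y →
      |g x - g y| ≤ max |k m (x - y)| (‖x - y‖ / 2) := by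
    intro m x y hx hy
    rw [hx, hy]
    have := abs_clippedFunctional_sub_le (k m) (x - p m) (y - p m)
    rwa [sub_sub_sub_cancel_right] at this
  refine ⟨g, ?_, fun x y => ?_, fun m => ⟨p m, fun z hz => ?_⟩⟩
  · rw [hg1 0 0 (by simp [p])]
    simp [F, p, clippedFunctional]
  · by_cases hx : ∃ m, ‖x - p m‖ < 2
    · obtain ⟨m, hm⟩ := hx
      refine ⟨m, ?_⟩
      by_cases hy : ∃ n, ‖y - p n‖ < 2
      · obtain ⟨n, hn⟩ := hy
        rcases eq_or_ne m n with rfl | hmn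
        · exact hsame m x y (hg1 m x hm) (hg1 m y hn)
        · have h1 := hfar m n x y hmn hm hn
          refine le_max_of_le_right ?_
          rw [hg1 m x hm, hg1 n y hn]
          have h2 := abs_sub (F m x) (F n y)
          have h3 := abs_clippedFunctional_le_one (k m) (x - p m)
          have h4 := abs_clippedFunctional_le_one (k n) (y - p n)
          change |F m x| ≤ 1 at h3
          change |F n y| ≤ 1 at h4
          linarith
      · push Not at hy
        exact hsame m x y (hg1 m x hm) ((hg0 y hy).trans (hzero m y (hy m)).symm)
    · push Not at hx
      by_cases hy : ∃ n, ‖y - p n‖ < 2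
      · obtain ⟨n, hn⟩ := hy
        exact ⟨n, hsame n x y ((hg0 x hx).trans (hzero n x (hx n)).symm) (hg1 n y hn)⟩
      · push Not at hy
        refine ⟨0, ?_⟩
        rw [hg0 x hx, hg0 y hy, sub_zero, abs_zero]
        exact le_max_of_le_left (abs_nonneg _)
  · have h1 : ‖p m + z - p m‖ < 2 := by rw [add_sub_cancel_left]; linarith
    rw [hg1 m _ h1, hg1 m (p m) (by simp)]
    simp only [F, add_sub_cancel_left, sub_self]
    rw [clippedFunctional_eq_apply (hk m) hz, clippedFunctional_eq_apply (hk m) (by simp),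
      map_zero, sub_zero]

end clippedFunctional

theorem stmt11 {X : Type*} [NormedAddCommGroup X] [NormedSpace ℝ X]
    [CompleteSpace X] [Nontrivial X]
    (h : ∀ (g : X → ℝ) (L : ℝ), g 0 = 0 → IsLipNorm g L →
      ∃ u : X, ‖u‖ = 1 ∧ AttainsAtDirection g L u) :
    FiniteDimensional ℝ X := by
  by_contra hX
  obtain ⟨k, hk1, hk, hku⟩ := exists_seq_norm_le_one_apply_le hX
  obtain ⟨g, hg0, hg, hgp⟩ := exists_piecewise_clippedFunctional hk1
  have hlip : IsLipNorm g 1 := by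
    refine ⟨⟨zero_le_one, fun x y => ?_⟩, fun K hK => ?_⟩
    · obtain ⟨m, hm⟩ := hg x y
      rw [one_mul, dist_eq_norm]
      refine hm.trans (max_le ?_ (half_le_self (norm_nonneg _)))
      exact ((k m).le_opNorm _).trans (mul_le_of_le_one_left (norm_nonneg _) (hk1 m))
    · obtain ⟨hK0, hK⟩ := hK
      have hkK : ∀ m, ‖k m‖ ≤ K := fun m => by
        obtain ⟨p, hp⟩ := hgp m
        refine (k m).opNorm_le_of_ball (ε := 1 / 2) (by norm_num) hK0 fun z hz => ?_
        rw [Real.norm_eq_abs, ← hp z (mem_ball_zero_iff.1 hz).le]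
        simpa using hK (p + z) p
      refine le_of_forall_pos_le_add fun ε hε => ?_
      obtain ⟨m, hm⟩ := hk ε hε
      linarith [hkK m]
  obtain ⟨u, hu, xs, ys, hne, hdir, hslope⟩ := h g 1 hg0 hlip
  obtain ⟨c, hc1, hc⟩ := hku u hu.le
  obtain ⟨d, hd1, hd⟩ := hku (-u) (by rw [norm_neg, hu])
  set b := max (max c d) (1 / 2)
  have hb : b < 1 := max_lt (max_lt hc1 hd1) (by norm_num)
  have habs : ∀ m, |k m u| ≤ b := fun m => by
    have h1 := hd m
    rw [map_neg] at h1
    have h2 : c ≤ b := (le_max_left _ _).trans (le_max_left _ _)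
    have h3 : d ≤ b := (le_max_right _ _).trans (le_max_left _ _)
    exact abs_le.2 ⟨by linarith, (hc m).trans h2⟩
  have hlim : Tendsto (fun n => b + ‖‖xs n - ys n‖⁻¹ • (xs n - ys n) - u‖) atTop (𝓝 b) := by
    simpa using tendsto_const_nhds.add (tendsto_iff_norm_sub_tendsto_zero.1 hdir)
  refine hb.not_ge (le_of_tendsto_of_tendsto' hslope hlim fun n => ?_)
  have hpos : 0 < ‖xs n - ys n‖ := norm_pos_iff.2 (sub_ne_zero.2 (hne n))
  set v := ‖xs n - ys n‖⁻¹ • (xs n - ys n) with hv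
  obtain ⟨m, hm⟩ := hg (xs n) (ys n)
  have hkv : |k m v| ≤ b + ‖v - u‖ := by
    have h1 : k m v = k m u + k m (v - u) := by rw [← map_add, add_sub_cancel]
    have h2 : |k m (v - u)| ≤ ‖v - u‖ :=
      ((k m).le_opNorm _).trans (mul_le_of_le_one_left (norm_nonneg _) (hk1 m))
    rw [h1]
    exact (abs_add_le _ _).trans (add_le_add (habs m) h2)
  have hxy : xs n - ys n = ‖xs n - ys n‖ • v := by
    rw [hv, smul_smul, mul_inv_cancel₀ hpos.ne', one_smul]
  rw [div_le_iff₀ hpos]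
  refine (le_abs_self _).trans (hm.trans (max_le ?_ ?_))
  · rw [hxy, map_smul, smul_eq_mul, abs_mul, abs_norm, ← hxy, mul_comm]
    exact mul_le_mul_of_nonneg_right hkv hpos.le
  · have h1 : 1 / 2 ≤ b := le_max_right _ _
    nlinarith [norm_nonneg (v - u)]
end

section
/- Let X be a finite-dimensional real normed space with X ≠ {0}. Then every f ∈ Lip_0(X) attains its norm directionally, i.e. DA(X) = Lip_0(X). -/
open Filter Topology

theorem IsLipNorm.exists_lt_div {X : Type*} [NormedAddCommGroup X] [Nontrivial X]
    {g : X → ℝ} {L : ℝ} (hg : IsLipNorm g L) {ε : ℝ} (hε : 0 < ε) :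
    ∃ x y : X, x ≠ y ∧ L - ε < (g x - g y) / ‖x - y‖ := by
  by_contra! h
  have key : ∀ x y : X, g x - g y ≤ (L - ε) * dist x y := by
    intro x y
    rcases eq_or_ne x y with rfl | hxy
    · simp
    · have := h x y hxy
      rwa [div_le_iff₀ (norm_pos_iff.2 (sub_ne_zero.2 hxy)), ← dist_eq_norm] at this
  obtain ⟨a, b, hab⟩ := exists_pair_ne X
  have hpos : 0 ≤ L - ε := by
    have h1 := key a b
    have h2 := key b a
    rw [dist_comm b a] at h2
    have hd := dist_pos.2 hab
    by_contra! hneg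
    linarith [mul_neg_of_neg_of_pos hneg hd]
  have hle : L ≤ L - ε := hg.2 ⟨hpos, fun x y => abs_sub_le_iff.2
    ⟨key x y, by simpa only [dist_comm] using key y x⟩⟩
  linarith

theorem IsLipNorm.div_le {X : Type*} [NormedAddCommGroup X]
    {g : X → ℝ} {L : ℝ} (hg : IsLipNorm g L) (x y : X) :
    (g x - g y) / ‖x - y‖ ≤ L := by
  refine div_le_of_le_mul₀ (norm_nonneg _) hg.1.1 ?_
  rw [← dist_eq_norm]
  exact (le_abs_self _).trans (hg.1.2 x y)

theorem stmt12 {X : Type*} [NormedAddCommGroup X] [NormedSpace ℝ X]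
    [FiniteDimensional ℝ X] [Nontrivial X]
    (g : X → ℝ) (L : ℝ) (hg0 : g 0 = 0) (hgL : IsLipNorm g L) :
    ∃ u : X, ‖u‖ = 1 ∧ AttainsAtDirection g L u := by
  choose xs ys hne hlt using fun n : ℕ =>
    hgL.exists_lt_div (Nat.one_div_pos_of_nat (α := ℝ) (n := n))
  have hlim : Tendsto (fun n => (g (xs n) - g (ys n)) / ‖xs n - ys n‖) atTop (𝓝 L) := by
    refine tendsto_of_tendsto_of_tendsto_of_le_of_le ?_ tendsto_const_nhds
      (fun n => (hlt n).le) (fun n => hgL.div_le _ _)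
    simpa using tendsto_const_nhds.sub (tendsto_one_div_add_atTop_nhds_zero_nat (𝕜 := ℝ))
  have : ProperSpace X := FiniteDimensional.proper ℝ X
  obtain ⟨u, hu, φ, hφ, hφu⟩ := (isCompact_sphere (0 : X) 1).tendsto_subseq
    (x := fun n => ‖xs n - ys n‖⁻¹ • (xs n - ys n)) fun n =>
      mem_sphere_zero_iff_norm.2 (norm_smul_inv_norm (𝕜 := ℝ) (sub_ne_zero.2 (hne n)))
  exact ⟨u, mem_sphere_zero_iff_norm.1 hu, xs ∘ φ, ys ∘ φ, fun n => hne _, hφu,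
    hlim.comp hφ.tendsto_atTop⟩
end

section
/- Let X be a real Banach space with X ≠ {0}. Then for every ε > 0 there exists δ > 0 such that for every continuous seminorm p_0 on X with sup{p_0(x) : ‖x‖=1} = 1 and every x_0 ∈ X with ‖x_0‖ = 1 and p_0(x_0) > 1-δ, there exist a continuous seminorm p on X with sup{p(z) : ‖z‖=1} = 1 and x ∈ X with ‖x‖ = 1 such that p(x) = 1, ‖x - x_0‖ < ε, and sup{|p(z)-p_0(z)| : ‖z‖=1} < ε. -/
open Filter Topology

/-- Ekeland's variational principle for a continuous function that is bounded above on a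
closed set. -/
theorem exists_ekeland_maximizer {E : Type*} [MetricSpace E] [CompleteSpace E] {s : Set E}
    (hs : IsClosed s) {φ : E → ℝ} (hφ : Continuous φ) (hb : BddAbove (φ '' s)) {k : ℝ}
    (hk : 0 < k) {x₀ : E} (hx₀ : x₀ ∈ s) :
    ∃ x ∈ s, k * dist x x₀ ≤ φ x - φ x₀ ∧
      ∀ y ∈ s, k * dist y x ≤ φ y - φ x → y = x := by
  let S : E → Set E := fun x => {y | y ∈ s ∧ k * dist y x ≤ φ y - φ x}
  have hself : ∀ x ∈ s, x ∈ S x := fun x hx => ⟨hx, by simp⟩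
  have htrans : ∀ {x y z}, y ∈ S x → z ∈ S y → z ∈ S x := by
    rintro x y z ⟨-, hyx⟩ ⟨hz, hzy⟩
    refine ⟨hz, ?_⟩
    have := mul_le_mul_of_nonneg_left (dist_triangle z y x) hk.le
    linarith
  have hclosed : ∀ x, IsClosed (S x) := fun x =>
    hs.inter (isClosed_le (f := fun y => k * dist y x) (g := fun y => φ y - φ x)
      (by fun_prop) (by fun_prop))
  have hstep : ∀ (n : ℕ) (x : s), ∃ y : s, (y : E) ∈ S x ∧
      ∀ z ∈ S x, φ z ≤ φ y + (1 / 2 : ℝ) ^ n := by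
    rintro n ⟨x, hx⟩
    have hne : (φ '' S x).Nonempty := ⟨_, x, hself x hx, rfl⟩
    have hbd : BddAbove (φ '' S x) := hb.mono (Set.image_mono fun y hy => hy.1)
    obtain ⟨_, ⟨y, hy, rfl⟩, hlt⟩ := exists_lt_of_lt_csSup hne
      (sub_lt_self (sSup (φ '' S x)) (pow_pos (one_half_pos (α := ℝ)) n))
    refine ⟨⟨y, hy.1⟩, hy, fun z hz => ?_⟩
    have := le_csSup hbd ⟨z, hz, rfl⟩
    simp only
    linarith
  choose next hnext hmax using hstep
  obtain ⟨u, hu0, husucc⟩ : ∃ u : ℕ → s, u 0 = ⟨x₀, hx₀⟩ ∧ ∀ n, u (n + 1) = next n (u n) :=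
    ⟨fun n => Nat.rec ⟨x₀, hx₀⟩ next n, rfl, fun _ => rfl⟩
  have hu : ∀ n m, n ≤ m → (u m : E) ∈ S (u n) := by
    intro n m hnm
    induction m, hnm using Nat.le_induction with
    | base => exact hself _ (u n).2
    | succ m _ ih => exact htrans ih (husucc m ▸ hnext m (u m))
  have hmono : Monotone fun n => φ (u n) := by
    intro n m hnm
    have h := (hu n m hnm).2
    have : 0 ≤ k * dist (u m : E) (u n) := by positivity
    simp only
    linarith
  have hbdd : BddAbove (Set.range fun n => φ (u n)) :=
    hb.mono (by rintro _ ⟨n, rfl⟩; exact ⟨u n, (u n).2, rfl⟩)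
  have hcauchy : CauchySeq fun n => (u n : E) := by
    have hc := (tendsto_atTop_ciSup hmono hbdd).cauchySeq
    rw [Metric.cauchySeq_iff'] at hc ⊢
    intro ε hε
    obtain ⟨N, hN⟩ := hc (k * ε) (by positivity)
    refine ⟨N, fun n hn => ?_⟩
    have h1 := (hu N n hn).2
    have h2 := (le_abs_self _).trans_lt (hN n hn)
    exact lt_of_mul_lt_mul_left (h1.trans_lt h2) hk.le
  obtain ⟨x, hx⟩ := cauchySeq_tendsto_of_complete hcauchy
  have hxS : ∀ n, x ∈ S (u n) := fun n =>
    (hclosed _).mem_of_tendsto hx (eventually_atTop.2 ⟨n, hu n⟩)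
  have hx0 := hxS 0
  rw [hu0] at hx0
  refine ⟨x, hx0.1, hx0.2, fun y hy hyx => ?_⟩
  have hle : ∀ n : ℕ, φ y ≤ φ x + (1 / 2 : ℝ) ^ n := by
    intro n
    have h1 := hmax n (u n) y (htrans (hxS n) ⟨hy, hyx⟩)
    have h2 := (hxS (n + 1)).2
    have h3 : 0 ≤ k * dist x (u (n + 1)) := by positivity
    have h4 : φ (next n (u n)) = φ (u (n + 1)) := by rw [husucc]
    linarith
  have hlim : Tendsto (fun n : ℕ => φ x + (1 / 2 : ℝ) ^ n) atTop (𝓝 (φ x + 0)) :=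
    tendsto_const_nhds.add (tendsto_pow_atTop_nhds_zero_of_lt_one (by norm_num) (by norm_num))
  have hle' := ge_of_tendsto' hlim hle
  have : k * dist y x ≤ k * 0 := by linarith
  exact dist_le_zero.1 (le_of_mul_le_mul_left this hk)

/-- A seminorm on a real vector space is supported at every nonzero vector by a linear
functional that it dominates. -/
theorem Seminorm.exists_dual_eq_of_ne_zero {E : Type*} [AddCommGroup E] [Module ℝ E]
    (q : Seminorm ℝ E) {x₀ : E} (hx₀ : x₀ ≠ 0) :
    ∃ f : Module.Dual ℝ E, f x₀ = q x₀ ∧ ∀ z, |f z| ≤ q z := by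
  let c := LinearEquiv.toSpanNonzeroSingleton ℝ E x₀ hx₀
  obtain ⟨f, hf, hfq⟩ := Module.Dual.exists_extension_of_le_seminorm_real (Submodule.span ℝ {x₀})
    (q x₀ • c.symm.toLinearMap) (p := q) (fun y => by
      obtain ⟨l, rfl⟩ := c.surjective y
      have hl : ((c l : Submodule.span ℝ {x₀}) : E) = l • x₀ := rfl
      rw [hl, map_smul_eq_mul, Real.norm_eq_abs, LinearMap.smul_apply, LinearEquiv.coe_coe,
        c.symm_apply_apply, smul_eq_mul, mul_comm]
      exact mul_le_mul_of_nonneg_right (le_abs_self l) (apply_nonneg q x₀))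
  refine ⟨f, ?_, hfq⟩
  have h := hf (c 1)
  have h1 : ((c 1 : Submodule.span ℝ {x₀}) : E) = x₀ := one_smul ℝ x₀
  rwa [h1, LinearMap.smul_apply, LinearEquiv.coe_coe, c.symm_apply_apply, smul_eq_mul,
    mul_one] at h

/-- A form of the Bishop–Phelps–Bollobás theorem, in which the closeness of the functionals is
one-sided and expressed through their absolute values. -/
theorem exists_norm_attaining_near {X : Type*} [NormedAddCommGroup X] [NormedSpace ℝ X]
    [CompleteSpace X] {ε : ℝ} (hε : 0 < ε) (hε1 : ε ≤ 1) (f : StrongDual ℝ X)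
    (hf : ∀ z, |f z| ≤ ‖z‖) {x₀ : X} (hx₀ : ‖x₀‖ = 1) (hfx₀ : 1 - ε ^ 2 / 32 < f x₀) :
    ∃ (g : StrongDual ℝ X) (x : X), (∀ z, |g z| ≤ ‖z‖) ∧ ‖x‖ = 1 ∧ g x = 1 ∧
      ‖x - x₀‖ ≤ ε / 2 ∧ ∀ z, |g z| ≤ |f z| + ε / 2 * ‖z‖ := by
  obtain ⟨x, hx, hxx₀, hmax⟩ := exists_ekeland_maximizer (s := Metric.closedBall (0 : X) 1)
    Metric.isClosed_closedBall f.continuous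
    ⟨1, by
      rintro _ ⟨z, hz, rfl⟩
      exact (le_abs_self _).trans ((hf z).trans (mem_closedBall_zero_iff.1 hz))⟩
    (k := ε / 16) (by positivity) (mem_closedBall_zero_iff.2 hx₀.le)
  simp only [mem_closedBall_zero_iff, dist_eq_norm] at hx hxx₀ hmax
  have hfx₀half : 1 / 2 < f x₀ := by nlinarith
  have hfx₀le : f x₀ ≤ 1 := hx₀ ▸ (le_abs_self _).trans (hf x₀)
  have hfxle : f x ≤ 1 := (le_abs_self _).trans ((hf x).trans hx)
  have hfx : f x₀ ≤ f x := by
    have : 0 ≤ ε / 16 * ‖x - x₀‖ := by positivity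
    linarith
  have hx1 : ‖x‖ = 1 := by
    by_contra hne
    have hlt : 0 < 1 - ‖x‖ := sub_pos.2 (lt_of_le_of_ne hx hne)
    have hnorm : ‖(1 - ‖x‖) • x₀‖ = 1 - ‖x‖ := by
      rw [norm_smul, hx₀, Real.norm_of_nonneg hlt.le, mul_one]
    have h := hmax (x + (1 - ‖x‖) • x₀) (by linarith [norm_add_le x ((1 - ‖x‖) • x₀)]) (by
      rw [add_sub_cancel_left, hnorm, map_add, map_smul, smul_eq_mul]
      nlinarith)
    rw [add_eq_left] at h
    rw [h, norm_zero] at hnorm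
    linarith
  obtain ⟨g, u, hball, hcone⟩ := geometric_hahn_banach_open (s := Metric.ball (0 : X) 1)
    (t := {y | ε / 16 * ‖y - x‖ ≤ f y - f x}) (convex_ball 0 1) Metric.isOpen_ball
    (by
      intro a ha b hb s t hs ht hst
      simp only [Set.mem_ofPred_eq] at ha hb ⊢
      have hsplit : s • a + t • b - x = s • (a - x) + t • (b - x) := by
        rw [smul_sub, smul_sub, sub_add_sub_comm, ← add_smul, hst, one_smul]
      have hn : ‖s • a + t • b - x‖ ≤ s * ‖a - x‖ + t * ‖b - x‖ := by
        rw [hsplit]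
        refine (norm_add_le _ _).trans_eq ?_
        rw [norm_smul_of_nonneg hs, norm_smul_of_nonneg ht]
      have hfeq : f (s • a + t • b) - f x = s * (f a - f x) + t * (f b - f x) := by
        rw [← map_sub, hsplit]
        simp
      rw [hfeq]
      calc ε / 16 * ‖s • a + t • b - x‖ ≤ ε / 16 * (s * ‖a - x‖ + t * ‖b - x‖) := by gcongr
        _ = s * (ε / 16 * ‖a - x‖) + t * (ε / 16 * ‖b - x‖) := by ring
        _ ≤ _ := by gcongr)
    (Set.disjoint_left.2 fun y hy hyt => by
      rw [mem_ball_zero_iff] at hy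
      have := hmax y hy.le hyt
      rw [this, hx1] at hy
      exact lt_irrefl _ hy)
  have hu : 0 < u := by simpa using hball 0 (by simp)
  have hgle : ∀ z, g z ≤ u * ‖z‖ := by
    intro z
    rw [← div_le_iff₀' hu]
    refine le_of_forall_gt_imp_ge_of_dense fun r hr => ?_
    have hr0 : 0 < r := (norm_nonneg z).trans_lt hr
    have h := hball (r⁻¹ • z) (by
      rw [mem_ball_zero_iff, norm_smul_of_nonneg (by positivity), inv_mul_lt_one₀ hr0]
      exact hr)
    rw [map_smul, smul_eq_mul, inv_mul_lt_iff₀ hr0] at h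
    rw [div_le_iff₀ hu]
    exact h.le
  have hgx : g x = u :=
    le_antisymm (by simpa [hx1] using hgle x) (hcone x (by simp))
  have hpos : ∀ v, ε / 16 * ‖v‖ ≤ f v → 0 ≤ (u⁻¹ • g) v := by
    intro v hv
    have h := hcone (x + v) (by simpa using hv)
    rw [map_add, hgx] at h
    have : 0 ≤ g v := by linarith
    simpa using mul_nonneg (inv_pos.2 hu).le this
  have hGle : ∀ z, |(u⁻¹ • g) z| ≤ ‖z‖ := by
    have h : ∀ z, (u⁻¹ • g) z ≤ ‖z‖ := fun z => by
      simpa using (inv_mul_le_iff₀ hu).2 (hgle z)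
    exact fun z => abs_le.2 ⟨by have := h (-z); rw [map_neg, norm_neg] at this; linarith, h z⟩
  have hGx : (u⁻¹ • g) x = 1 := by simp [hgx, hu.ne']
  generalize u⁻¹ • g = G at hpos hGle hGx
  have hker : ∀ y, f y = 0 → 7 * |G y| ≤ ε * ‖y‖ := by
    have h : ∀ y, f y = 0 → 0 ≤ ε * ‖y‖ + 7 * G y := by
      intro y hy
      have hn : ‖(ε * ‖y‖) • x + (7 : ℝ) • y‖ ≤ 8 * ‖y‖ := by
        refine (norm_add_le _ _).trans ?_
        rw [norm_smul_of_nonneg (by positivity), norm_smul_of_nonneg (by norm_num), hx1]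
        nlinarith [norm_nonneg y]
      have hv := hpos ((ε * ‖y‖) • x + (7 : ℝ) • y) (by
        rw [map_add, map_smul, map_smul, hy, smul_zero, add_zero, smul_eq_mul]
        have h1 := mul_le_mul_of_nonneg_left hn (by positivity : 0 ≤ ε / 16)
        have h2 : ε * ‖y‖ * (1 / 2) ≤ ε * ‖y‖ * f x := by
          gcongr
          linarith
        linarith)
      simpa [hGx] using hv
    intro y hy
    have h1 := h y hy
    have h2 := h (-y) (by rw [map_neg, hy, neg_zero])
    rw [map_neg, norm_neg] at h2
    rcases abs_cases (G y) with ⟨h3, -⟩ | ⟨h3, -⟩ <;> rw [h3] <;> linarith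
  refine ⟨G, x, hGle, hx1, hGx, ?_, fun z => ?_⟩
  · have h : ε / 16 * ‖x - x₀‖ ≤ ε / 16 * (ε / 2) := by nlinarith
    exact le_of_mul_le_mul_left h (by positivity)
  · have h := hker (f x • z - f z • x) (by simp [mul_comm])
    have hn : ‖f x • z - f z • x‖ ≤ 2 * ‖z‖ := by
      refine (norm_sub_le _ _).trans ?_
      rw [norm_smul_of_nonneg (by linarith), norm_smul, hx1, Real.norm_eq_abs]
      nlinarith [hf z, norm_nonneg z]
    have hG : G (f x • z - f z • x) = f x * G z - f z := by simp [hGx]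
    rw [hG] at h
    have h1 : f x * |G z| ≤ |f x * G z - f z| + |f z| := by
      have := abs_add_le (f x * G z - f z) (f z)
      rwa [sub_add_cancel, abs_mul, abs_of_pos (by linarith : 0 < f x)] at this
    have h2 : (1 - f x) * |G z| ≤ ε / 32 * ‖z‖ := by
      apply mul_le_mul _ (hGle z) (abs_nonneg _) (by positivity)
      nlinarith
    have h3 := mul_le_mul_of_nonneg_left hn hε.le
    have h4 : 0 ≤ ε * ‖z‖ := by positivity
    linarith

theorem stmt13 {X : Type*} [NormedAddCommGroup X] [NormedSpace ℝ X]
    [CompleteSpace X] [Nontrivial X] :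
    ∀ ε > (0:ℝ), ∃ δ > (0:ℝ),
      ∀ p₀ : X → ℝ, (∀ (l : ℝ) (x : X), p₀ (l • x) = |l| * p₀ x) →
        (∀ x y : X, p₀ (x + y) ≤ p₀ x + p₀ y) → Continuous p₀ →
        sSup (p₀ '' {x : X | ‖x‖ = 1}) = 1 →
        ∀ x₀ : X, ‖x₀‖ = 1 → p₀ x₀ > 1 - δ →
          ∃ (p : X → ℝ) (x : X),
            (∀ (l : ℝ) (z : X), p (l • z) = |l| * p z) ∧
            (∀ z w : X, p (z + w) ≤ p z + p w) ∧ Continuous p ∧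
            sSup (p '' {z : X | ‖z‖ = 1}) = 1 ∧
            ‖x‖ = 1 ∧ p x = 1 ∧ ‖x - x₀‖ < ε ∧
            sSup ((fun z => |p z - p₀ z|) '' {z : X | ‖z‖ = 1}) < ε := by
  intro ε hε
  set η := min ε 1
  have hη0 : 0 < η := lt_min hε one_pos
  refine ⟨η ^ 2 / 32, by positivity, fun p₀ hsmul hadd hcont hsup x₀ hx₀ hpx₀ => ?_⟩
  obtain ⟨e, he⟩ := exists_norm_eq X (zero_le_one (α := ℝ))
  have hbdd : BddAbove (p₀ '' {x : X | ‖x‖ = 1}) := by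
    by_contra h
    rw [Real.sSup_of_not_bddAbove h] at hsup
    exact zero_ne_one hsup
  have hp₀le : ∀ z, p₀ z ≤ ‖z‖ := by
    intro z
    rcases eq_or_ne z 0 with rfl | hz
    · simpa using (hsmul 0 0).le
    have h := le_csSup hbdd ⟨‖z‖⁻¹ • z, by simp [norm_smul, hz], rfl⟩
    rwa [hsup, hsmul, abs_of_nonneg (by positivity), inv_mul_le_one₀ (norm_pos_iff.2 hz)] at h
  obtain ⟨f, hfx₀, hf⟩ : ∃ f : Module.Dual ℝ X, f x₀ = p₀ x₀ ∧ ∀ z, |f z| ≤ p₀ z :=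
    (Seminorm.of p₀ hadd hsmul).exists_dual_eq_of_ne_zero (norm_ne_zero_iff.1 (by simp [hx₀]))
  obtain ⟨g, x, hg, hx, hgx, hxx₀, hgf⟩ := exists_norm_attaining_near hη0 (min_le_right _ _)
    (f.mkContinuous 1 fun z => by simpa using (hf z).trans (hp₀le z))
    (fun z => (hf z).trans (hp₀le z)) hx₀ (hfx₀ ▸ hpx₀)
  have hηε : η / 2 < ε := by linarith [min_le_left ε 1]
  have hple : ∀ z, max (p₀ z) |g z| ≤ ‖z‖ := fun z => max_le (hp₀le z) (hg z)
  have hpx : max (p₀ x) |g x| = 1 := le_antisymm (hx ▸ hple x) (by simp [hgx])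
  refine ⟨fun z => max (p₀ z) |g z|, x, fun l z => ?_, fun z w => ?_, by fun_prop, ?_, hx, hpx,
    hxx₀.trans_lt hηε, ?_⟩
  · simp only [hsmul, map_smul, smul_eq_mul, abs_mul]
    exact (mul_max_of_nonneg _ _ (abs_nonneg l)).symm
  · refine max_le ((hadd z w).trans (add_le_add (le_max_left _ _) (le_max_left _ _))) ?_
    rw [map_add]
    exact (abs_add_le _ _).trans (add_le_add (le_max_right _ _) (le_max_right _ _))
  · refine IsGreatest.csSup_eq ⟨⟨x, hx, hpx⟩, ?_⟩
    rintro _ ⟨z, hz, rfl⟩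
    exact (hple z).trans_eq hz
  · refine lt_of_le_of_lt (csSup_le ⟨_, e, he, rfl⟩ ?_) hηε
    rintro _ ⟨z, hz, rfl⟩
    have h1 : |g z| ≤ |f z| + η / 2 * ‖z‖ := hgf z
    rw [Set.mem_ofPred_eq] at hz
    rw [hz, mul_one] at h1
    have h2 : 0 ≤ max (p₀ z) |g z| - p₀ z := sub_nonneg.2 (le_max_left _ _)
    simp only [abs_of_nonneg h2, sub_le_iff_le_add]
    exact max_le (by linarith) (by linarith [hf z])
end

section
/- Let X = ℝ² endowed with the maximum norm ‖(x_1,x_2)‖ = max{|x_1|,|x_2|}. Define seminorms p_0(x_1,x_2) = |x_1| and, for each n ∈ ℕ, p_n(x_1,x_2) = max{|x_1|, |x_2|/n}. Then sup{|p_n(z)-p_0(z)| : ‖z‖=1} ≤ 1/n for every n (so p_n → p_0 uniformly on the unit sphere), while the smallest Lipschitz constant of p_n - p_0 is at least 1 for every n (so p_n does not converge to p_0 in the Lipschitz norm). -/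
open Filter Topology

/- Here `ℝ × ℝ` carries the maximum norm: `‖(x₁, x₂)‖ = max |x₁| |x₂|`.
`p₀ (x₁,x₂) = |x₁|` and `pₙ (x₁,x₂) = max |x₁| (|x₂|/n)`. -/
theorem stmt14 :
    ∀ n : ℕ, 1 ≤ n →
      (sSup ((fun z : ℝ × ℝ => abs (max (abs z.1) (abs z.2 / (n : ℝ)) - abs z.1)) ''
          {z : ℝ × ℝ | ‖z‖ = 1}) ≤ 1 / (n : ℝ)) ∧
      (∀ L : ℝ,
        IsLipNorm (fun z : ℝ × ℝ => max (abs z.1) (abs z.2 / (n : ℝ)) - abs z.1) L →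
          1 ≤ L) := by
  intro n hn
  have hn0 : (0 : ℝ) < n := by exact_mod_cast hn
  refine ⟨Real.sSup_le ?_ (by positivity), ?_⟩
  · rintro _ ⟨z, hz, rfl⟩
    have hz2 : |z.2| ≤ 1 := by
      have h := norm_snd_le z
      rw [show ‖z‖ = 1 from hz] at h
      exact h
    have hdiv : |z.2| / (n : ℝ) ≤ 1 / n := by gcongr
    have hpos : (0 : ℝ) ≤ 1 / n := by positivity
    have hz1 := abs_nonneg z.1
    change abs (max (abs z.1) (abs z.2 / (n : ℝ)) - abs z.1) ≤ 1 / (n : ℝ)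
    rw [abs_of_nonneg (sub_nonneg.mpr (le_max_left _ _)), sub_le_iff_le_add]
    exact max_le (by linarith) (by linarith)
  · rintro L ⟨⟨-, hL⟩, -⟩
    simpa [Prod.dist_eq, hn0.ne'] using hL (0, n) (1, n)
end

section
/- Let X be a real Banach space. Suppose that for every ε > 0 there is δ > 0 such that for every f ∈ Lip_0(X) with ‖f‖ = 1 and every pair (x,y) ∈ X×X with x ≠ y and (f(x)-f(y))/‖x-y‖ > 1-δ, there exist g ∈ Lip_0(X) with ‖g‖ = 1 and a sequence of pairs (v_n,w_n) in X×X with v_n ≠ w_n for every n, such that (g(v_n)-g(w_n))/‖v_n-w_n‖ → 1, ‖g-f‖ < ε, and for all n: ‖(x-y)/‖x-y‖ - (v_n-w_n)/‖v_n-w_n‖‖ < ε, ‖v_n-w_n‖ < ε, and dist(v_n, conv{x,y}) < ε. Then X has the local directional Bishop-Phelps-Bollobás property for Lipschitz functionals. -/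
open Filter Topology

/-- `g` (with Lipschitz norm `L`) attains its norm in the point `v` at the direction `u`. -/
def AttainsAtPointDirection {X : Type*} [NormedAddCommGroup X] [NormedSpace ℝ X]
    (g : X → ℝ) (L : ℝ) (v u : X) : Prop :=
  ∃ xs ys : ℕ → X, (∀ n, xs n ≠ ys n) ∧
    Tendsto xs atTop (𝓝 v) ∧ Tendsto ys atTop (𝓝 v) ∧
    Tendsto (fun n => ‖xs n - ys n‖⁻¹ • (xs n - ys n)) atTop (𝓝 u) ∧
    Tendsto (fun n => (g (xs n) - g (ys n)) / ‖xs n - ys n‖) atTop (𝓝 L)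

/-- `X` has the local directional Bishop-Phelps-Bollobás property for Lipschitz
functionals. -/
def LocalDirLipBPB (X : Type*) [NormedAddCommGroup X] [NormedSpace ℝ X] : Prop :=
  ∀ ε > (0:ℝ), ∃ δ > (0:ℝ), ∀ f : X → ℝ, f 0 = 0 → IsLipNorm f 1 →
    ∀ x y : X, x ≠ y → (f x - f y) / ‖x - y‖ > 1 - δ →
      ∃ g : X → ℝ, g 0 = 0 ∧ IsLipNorm g 1 ∧
        ∃ v u : X, ‖u‖ = 1 ∧ AttainsAtPointDirection g 1 v u ∧
          (∃ M : ℝ, IsLipNorm (fun z => g z - f z) M ∧ M < ε) ∧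
          ‖‖x - y‖⁻¹ • (x - y) - u‖ < ε ∧
          Metric.infDist v (segment ℝ x y) < ε

/-- Dependent choice for a step-dependent invariant and relation. -/
theorem exists_seq_of_forall_exists_step {α : Type*} {P : ℕ → α → Prop} {R : ℕ → α → α → Prop}
    (h : ∀ n a, P n a → ∃ b, P (n + 1) b ∧ R n a b) (a : α) (ha : P 0 a) :
    ∃ s : ℕ → α, s 0 = a ∧ (∀ n, P n (s n)) ∧ ∀ n, R n (s n) (s (n + 1)) := by
  have : Nonempty α := ⟨a⟩
  choose! F hF using h
  let s : ℕ → α := fun n => Nat.rec a (fun n b => F n b) n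
  have hs : ∀ n, P n (s n) := by
    intro n
    induction n with
    | zero => exact ha
    | succ n ih => exact (hF n _ ih).1
  exact ⟨s, rfl, hs, fun n => (hF n _ (hs n)).2⟩

/-- A function with Lipschitz constant `K` has a Lipschitz norm, at most `K`. -/
theorem exists_isLipNorm_le {E : Type*} [PseudoMetricSpace E] {f : E → ℝ} {K : ℝ} (hK : 0 ≤ K)
    (hf : ∀ x y : E, |f x - f y| ≤ K * dist x y) : ∃ M : ℝ, IsLipNorm f M ∧ M ≤ K := by
  have hclosed : IsClosed {K : ℝ | 0 ≤ K ∧ ∀ x y : E, |f x - f y| ≤ K * dist x y} := by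
    simp only [Set.ofPred_and, Set.ofPred_forall]
    exact (isClosed_le continuous_const continuous_id).inter <|
      isClosed_iInter fun x => isClosed_iInter fun y =>
        isClosed_le continuous_const (continuous_id.mul continuous_const)
  have hbdd : BddBelow {K : ℝ | 0 ≤ K ∧ ∀ x y : E, |f x - f y| ≤ K * dist x y} :=
    ⟨0, fun _ h => h.1⟩
  have hmem : K ∈ {K : ℝ | 0 ≤ K ∧ ∀ x y : E, |f x - f y| ≤ K * dist x y} := ⟨hK, hf⟩
  exact ⟨_, hclosed.isLeast_csInf ⟨K, hmem⟩ hbdd, csInf_le hbdd hmem⟩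

/-- A point close to a segment is close to its left endpoint, up to the length of the segment. -/
theorem dist_left_lt_of_infDist_segment_lt {X : Type*} [NormedAddCommGroup X] [NormedSpace ℝ X]
    {a b v : X} {r : ℝ} (h : Metric.infDist v (segment ℝ a b) < r) :
    dist a v < r + ‖a - b‖ := by
  obtain ⟨z, hz, hvz⟩ := (Metric.infDist_lt_iff ⟨a, left_mem_segment ℝ a b⟩).1 h
  have hsub : segment ℝ a b ⊆ Metric.closedBall a ‖a - b‖ :=
    (convex_closedBall a _).segment_subset (Metric.mem_closedBall_self (norm_nonneg _))
      (by rw [Metric.mem_closedBall, dist_comm, dist_eq_norm])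
  have hza : dist z a ≤ ‖a - b‖ := hsub hz
  have := dist_triangle a z v
  rw [dist_comm a z, dist_comm z v] at this
  linarith

/-- A function with Lipschitz constant `1` whose difference quotients along a sequence of pairs
tend to `1` has Lipschitz norm `1`. -/
theorem isLipNorm_one_of_tendsto {X : Type*} [NormedAddCommGroup X] {g : X → ℝ}
    (hg : ∀ x y : X, |g x - g y| ≤ dist x y) {xs ys : ℕ → X} (hne : ∀ n, xs n ≠ ys n)
    (h : Tendsto (fun n => (g (xs n) - g (ys n)) / ‖xs n - ys n‖) atTop (𝓝 1)) :
    IsLipNorm g 1 := by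
  refine ⟨⟨zero_le_one, by simpa using hg⟩, fun K hK => ?_⟩
  refine le_of_tendsto' h fun n => ?_
  rw [div_le_iff₀ (norm_sub_pos_iff.2 (hne n)), ← dist_eq_norm]
  exact (le_abs_self _).trans (hK.2 _ _)

/-- A sequence of functions whose consecutive differences have geometrically decaying Lipschitz
constants converges pointwise, with the corresponding rate for the Lipschitz constants. -/
theorem exists_tendsto_of_lipschitz_geometric {X : Type*} [PseudoMetricSpace X] {F : ℕ → X → ℝ}
    {o : X} (ho : ∀ n, F n o = 0) {C : ℝ}
    (hF : ∀ n x y, |(F (n + 1) x - F n x) - (F (n + 1) y - F n y)| ≤ C / 2 / 2 ^ n * dist x y) :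
    ∃ g : X → ℝ, (∀ x, Tendsto (fun n => F n x) atTop (𝓝 (g x))) ∧
      ∀ n x y, |(g x - F n x) - (g y - F n y)| ≤ C / 2 ^ n * dist x y := by
  have hlim : ∀ x, ∃ l, Tendsto (fun n => F n x) atTop (𝓝 l) := fun x => by
    refine cauchySeq_tendsto_of_complete
      (cauchySeq_of_le_geometric_two (C := C * dist x o) fun n => ?_)
    have := hF n x o
    rw [ho, ho, sub_self, sub_zero] at this
    rw [dist_comm, Real.dist_eq]
    exact this.trans_eq (by ring)
  choose g hg using hlim
  refine ⟨g, hg, fun n x y => ?_⟩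
  have := dist_le_of_le_geometric_two_of_tendsto (f := fun n => F n x - F n y)
    (C := C * dist x y) (fun n => ?_) ((hg x).sub (hg y)) n
  · rw [dist_comm, Real.dist_eq] at this
    refine (Eq.trans_le ?_ this).trans_eq (by ring)
    congr 1; ring
  · rw [dist_comm, Real.dist_eq]
    refine (Eq.trans_le ?_ (hF n x y)).trans_eq (by ring)
    congr 1; ring

theorem stmt16 {X : Type*} [NormedAddCommGroup X] [NormedSpace ℝ X] [CompleteSpace X]
    (hyp : ∀ ε > (0:ℝ), ∃ δ > (0:ℝ), ∀ f : X → ℝ, f 0 = 0 → IsLipNorm f 1 →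
      ∀ x y : X, x ≠ y → (f x - f y) / ‖x - y‖ > 1 - δ →
        ∃ g : X → ℝ, g 0 = 0 ∧ IsLipNorm g 1 ∧
          ∃ vs ws : ℕ → X, (∀ n, vs n ≠ ws n) ∧
            Tendsto (fun n => (g (vs n) - g (ws n)) / ‖vs n - ws n‖) atTop (𝓝 1) ∧
            (∃ M : ℝ, IsLipNorm (fun z => g z - f z) M ∧ M < ε) ∧
            ∀ n, ‖‖x - y‖⁻¹ • (x - y) - ‖vs n - ws n‖⁻¹ • (vs n - ws n)‖ < ε ∧
              ‖vs n - ws n‖ < ε ∧ Metric.infDist (vs n) (segment ℝ x y) < ε) :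
    LocalDirLipBPB X := by
  intro ε hε
  obtain ⟨C, hC⟩ : ∃ C : ℝ, C = ε / 8 := ⟨_, rfl⟩
  have hCpos : 0 < C := by linarith
  have he : ∀ n : ℕ, 0 < C / 2 / 2 ^ n := fun n => by positivity
  choose d hd hstep using fun n : ℕ => hyp (C / 2 / 2 ^ n) (he n)
  refine ⟨min (d 0) (C / 2 / 2 ^ 0), lt_min (hd 0) (he 0), fun f hf0 hf x y hxy hslope => ?_⟩
  obtain ⟨s, hs0, hP, hR⟩ := exists_seq_of_forall_exists_step
    (α := (X → ℝ) × X × X)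
    (P := fun n p => p.1 0 = 0 ∧ IsLipNorm p.1 1 ∧ p.2.1 ≠ p.2.2 ∧
      (p.1 p.2.1 - p.1 p.2.2) / ‖p.2.1 - p.2.2‖ > 1 - min (d n) (C / 2 / 2 ^ n))
    (R := fun n p q => (∀ z w, |(q.1 z - p.1 z) - (q.1 w - p.1 w)| ≤ C / 2 / 2 ^ n * dist z w) ∧
      ‖‖p.2.1 - p.2.2‖⁻¹ • (p.2.1 - p.2.2) - ‖q.2.1 - q.2.2‖⁻¹ • (q.2.1 - q.2.2)‖
        < C / 2 / 2 ^ n ∧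
      ‖q.2.1 - q.2.2‖ < C / 2 / 2 ^ n ∧
      Metric.infDist q.2.1 (segment ℝ p.2.1 p.2.2) < C / 2 / 2 ^ n)
    (by
      rintro n ⟨p, a, b⟩ ⟨hp0, hp, hab, hsl⟩
      dsimp only at hp0 hp hab hsl ⊢
      obtain ⟨g, hg0, hg, vs, ws, hne, hlim, ⟨M, hM, hMlt⟩, hall⟩ :=
        hstep n p hp0 hp a b hab
          (lt_of_le_of_lt (sub_le_sub_left (min_le_left _ _) _) hsl)
      obtain ⟨k, hk⟩ := (hlim.eventually (lt_mem_nhds (sub_lt_self (1 : ℝ)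
        (lt_min (hd (n + 1)) (he (n + 1)))))).exists
      exact ⟨⟨g, vs k, ws k⟩, ⟨hg0, hg, hne k, hk⟩, fun z w => (hM.1.2 z w).trans
        (mul_le_mul_of_nonneg_right hMlt.le dist_nonneg), hall k⟩)
    (f, x, y) ⟨hf0, hf, hxy, hslope⟩
  obtain ⟨g, hglim, hgF⟩ := exists_tendsto_of_lipschitz_geometric (F := fun n => (s n).1)
    (fun n => (hP n).1) (fun n => (hR n).1)
  have hpow : Tendsto (fun n : ℕ => C / 2 ^ n) atTop (𝓝 0) :=
    tendsto_const_nhds.div_atTop (tendsto_pow_atTop_atTop_of_one_lt one_lt_two)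
  have hg1 : ∀ z w : X, |g z - g w| ≤ dist z w := fun z w =>
    le_of_tendsto' ((hglim z).sub (hglim w)).abs fun n => by simpa using (hP n).2.1.1.2 z w
  have hgslope : Tendsto (fun n => (g (s n).2.1 - g (s n).2.2) / ‖(s n).2.1 - (s n).2.2‖)
      atTop (𝓝 1) := by
    have hlow : Tendsto (fun n : ℕ => 1 - 2 * (C / 2 ^ n)) atTop (𝓝 1) := by
      simpa using (hpow.const_mul 2).const_sub 1
    refine tendsto_of_tendsto_of_tendsto_of_le_of_le hlow tendsto_const_nhds
      (fun n => ?_) (fun n => ?_)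
    · have hpos := norm_sub_pos_iff.2 (hP n).2.2.1
      have h1 := (hP n).2.2.2
      have h2 := (abs_le.1 (hgF n (s n).2.1 (s n).2.2)).1
      rw [dist_eq_norm] at h2
      have h3 : min (d n) (C / 2 / 2 ^ n) ≤ C / 2 ^ n := (min_le_right _ _).trans <| by
        gcongr; linarith
      have h4 := (lt_div_iff₀ hpos).1 h1
      have h5 := mul_le_mul_of_nonneg_right h3 hpos.le
      refine (le_div_iff₀ hpos).2 ?_
      linarith
    · refine div_le_one_of_le₀ ?_ (norm_nonneg _)
      rw [← dist_eq_norm]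
      exact (le_abs_self _).trans (hg1 _ _)
  have hdir : ∀ n, dist (‖(s n).2.1 - (s n).2.2‖⁻¹ • ((s n).2.1 - (s n).2.2))
      (‖(s (n + 1)).2.1 - (s (n + 1)).2.2‖⁻¹ • ((s (n + 1)).2.1 - (s (n + 1)).2.2))
      ≤ C / 2 / 2 ^ n := fun n => by
    rw [dist_eq_norm]
    exact (hR n).2.1.le
  obtain ⟨u, hu⟩ := cauchySeq_tendsto_of_complete (cauchySeq_of_le_geometric_two hdir)
  have hpt : ∀ n, dist (s (n + 1)).2.1 (s (n + 1 + 1)).2.1 ≤ 2 * C / 2 / 2 ^ n := fun n => by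
    have h1 := dist_left_lt_of_infDist_segment_lt (hR (n + 1)).2.2.2
    have h2 := (hR n).2.2.1
    have h3 : C / 2 / 2 ^ (n + 1) = C / 2 / 2 ^ n / 2 := by rw [pow_succ]; ring
    have h4 : 2 * C / 2 / 2 ^ n = 2 * (C / 2 / 2 ^ n) := by ring
    have := he n
    linarith
  obtain ⟨v, hv⟩ := cauchySeq_tendsto_of_complete
    (cauchySeq_of_le_geometric_two (f := fun n => (s (n + 1)).2.1) hpt)
  have hdist : Tendsto (fun n => (s (n + 1)).2.1 - (s (n + 1)).2.2) atTop (𝓝 0) := by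
    refine squeeze_zero_norm (fun n => (hR n).2.2.1.le.trans ?_) hpow
    gcongr; linarith
  have hu1 : ‖u‖ = 1 := tendsto_nhds_unique hu.norm <| by
    refine tendsto_const_nhds.congr fun n => ?_
    rw [norm_smul, norm_inv, norm_norm, inv_mul_cancel₀ (norm_sub_pos_iff.2 (hP n).2.2.1).ne']
  refine ⟨g, tendsto_nhds_unique (hglim 0) (tendsto_const_nhds.congr fun n => (hP n).1.symm),
    isLipNorm_one_of_tendsto hg1 (fun n => (hP n).2.2.1) hgslope, v, u, hu1,
    ⟨fun n => (s (n + 1)).2.1, fun n => (s (n + 1)).2.2, fun n => (hP (n + 1)).2.2.1, hv, ?_,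
      hu.comp (tendsto_add_atTop_nat 1), hgslope.comp (tendsto_add_atTop_nat 1)⟩, ?_, ?_, ?_⟩
  · simpa using hv.sub hdist
  · obtain ⟨M, hM, hMC⟩ := exists_isLipNorm_le (f := fun z => g z - f z) hCpos.le
      (by simpa [hs0] using hgF 0)
    exact ⟨M, hM, by linarith⟩
  · have := dist_le_of_le_geometric_two_of_tendsto₀ hdir hu
    rw [hs0, dist_eq_norm] at this
    exact this.trans_lt (by linarith)
  · have h1 := dist_le_of_le_geometric_two_of_tendsto₀ (f := fun n => (s (n + 1)).2.1) hpt hv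
    have h2 := (hR 0).2.2.2
    rw [hs0] at h2
    have h3 := Metric.infDist_le_infDist_add_dist (s := segment ℝ x y) (x := v)
      (y := (s (0 + 1)).2.1)
    rw [dist_comm] at h3
    simp only [pow_zero, div_one] at h2
    linarith
end
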